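/- arXiv:1802.00307 — 5 statements merged into one kernel-verified Lean document; each statement's English description precedes it below -/
import Mathlib

section
/- For a local ring (R, m_R, k), the following are equivalent: (i) the maximal ideal m_R is decomposable and R is Gorenstein; (ii) the maximal ideal m_R is decomposable and R is a hypersurface of Krull dimension 1; (iii) R ≅ S ×_k T where (S, m_S, k) and (T, m_T, k) are regular local rings of Krull dimension 1, i.e., discrete valuation rings. -/
/-! Common definitions for formalizing Nasseh–Sather-Wagstaff–Takahashi–VandeBogert,
"Applications and homological properties of local rings with decomposable maximal ideals". -/

open CategoryTheory IsLocalRing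

noncomputable section

universe u

/-- The Ext module `Ext^i_R(M, N)`. -/
def extGrp (R : Type u) [CommRing R] (i : ℕ)
    (M N : Type u) [AddCommGroup M] [Module R M] [AddCommGroup N] [Module R N] :
    ModuleCat.{u} R :=
  ((Ext R (ModuleCat.{u} R) i).obj (Opposite.op (ModuleCat.of R M))).obj (ModuleCat.of R N)

/-- The depth of a module over a local ring:
`depth_R M = inf { i | Ext^i_R(k, M) ≠ 0 }`. -/
def moduleDepth (R : Type u) [CommRing R] [IsLocalRing R]
    (M : Type u) [AddCommGroup M] [Module R M] : ℕ∞ :=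
  sInf {n : ℕ∞ | ∃ i : ℕ, n = (i : ℕ∞) ∧
    ¬ Subsingleton (extGrp R i (ResidueField R) M)}

/-- The length of a module, i.e. the Krull dimension of its lattice of submodules. -/
def moduleLength (R : Type u) [CommRing R]
    (M : Type u) [AddCommGroup M] [Module R M] : WithBot ℕ∞ :=
  Order.krullDim (Submodule R M)

/-- A local ring is Cohen-Macaulay when its depth equals its Krull dimension. -/
def IsCohenMacaulayLocal (R : Type u) [CommRing R] [IsLocalRing R] : Prop :=
  (moduleDepth R R : WithBot ℕ∞) = ringKrullDim R

/-- `HasType R r` means the (Cohen-Macaulay) type of `R` is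
`r(R) = dim_k Ext^{depth R}_R(k, R)`; the `k`-dimension is recorded as the length
of this `R`-module (which is annihilated by the maximal ideal). -/
def HasType (R : Type u) [CommRing R] [IsLocalRing R] (r : ℕ) : Prop :=
  ∃ d : ℕ, moduleDepth R R = (d : ℕ∞) ∧
    moduleLength R (extGrp R d (ResidueField R) R) = (r : ℕ∞)

/-- The minimal number of generators of an ideal. -/
def minGens {R : Type u} [CommRing R] (I : Ideal R) : ℕ :=
  sInf {n : ℕ | ∃ s : Finset R, s.card = n ∧ Ideal.span (s : Set R) = I}

/-- `HasEcodepth R c` means the embedding codepth of `R`, namely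
`β₀(m_R) - depth R`, equals `c`. -/
def HasEcodepth (R : Type u) [CommRing R] [IsLocalRing R] (c : ℕ) : Prop :=
  ∃ d : ℕ, moduleDepth R R = (d : ℕ∞) ∧ minGens (maximalIdeal R) = c + d

/-- A local ring is a hypersurface iff its embedding codepth is at most 1. -/
def IsHypersurfaceLocal (R : Type u) [CommRing R] [IsLocalRing R] : Prop :=
  ∃ d : ℕ, moduleDepth R R = (d : ℕ∞) ∧ minGens (maximalIdeal R) ≤ d + 1

/-- A regular local ring: the maximal ideal is generated by `dim R` elements. -/
def IsRegularLocal (R : Type u) [CommRing R] [IsLocalRing R] : Prop :=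
  ∃ d : ℕ, ringKrullDim R = (d : WithBot ℕ∞) ∧ minGens (maximalIdeal R) = d

/-- `IsHSMultAt R I e`: the Hilbert–Samuel multiplicity of `R` with respect to the
ideal `I` is the positive integer `e`, i.e. `d! * length(R/I^{n+1}) / n^d → e`
where `d = dim R`. -/
def IsHSMultAt (R : Type u) [CommRing R] (I : Ideal R) (e : ℕ) : Prop :=
  0 < e ∧ ∃ (d : ℕ) (h : ℕ → ℕ), ringKrullDim R = (d : WithBot ℕ∞) ∧
    (∀ n : ℕ, moduleLength R (R ⧸ I ^ (n + 1)) = ((h n : ℕ∞) : WithBot ℕ∞)) ∧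
    Filter.Tendsto (fun n : ℕ => ((Nat.factorial d * h n : ℕ) : ℝ) / (n : ℝ) ^ d)
      Filter.atTop (nhds (e : ℝ))

/-- `IsHSMult R e`: the Hilbert–Samuel multiplicity `e(R)` of the local ring `R` is `e`. -/
def IsHSMult (R : Type u) [CommRing R] [IsLocalRing R] (e : ℕ) : Prop :=
  IsHSMultAt R (maximalIdeal R) e

/-- The maximal ideal of `R` is decomposable: `m_R = I ⊕ J` with `I, J ≠ 0`. -/
def HasDecomposableMaxIdeal (R : Type u) [CommRing R] [IsLocalRing R] : Prop :=
  ∃ I J : Ideal R, I ≠ ⊥ ∧ J ≠ ⊥ ∧ I ⊓ J = ⊥ ∧ I ⊔ J = maximalIdeal R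

/-- Auslander's condition (AC). -/
def SatisfiesAC (R : Type u) [CommRing R] : Prop :=
  ∀ (M : Type u) [AddCommGroup M] [Module R M], Module.Finite R M →
    ∃ b : ℕ, ∀ (N : Type u) [AddCommGroup N] [Module R N], Module.Finite R N →
      (∃ i₀ : ℕ, ∀ i ≥ i₀, Subsingleton (extGrp R i M N)) →
      ∀ i > b, Subsingleton (extGrp R i M N)

/-- The uniform Auslander condition (UAC). -/
def SatisfiesUAC (R : Type u) [CommRing R] : Prop :=
  ∃ b : ℕ, ∀ (M : Type u) [AddCommGroup M] [Module R M], Module.Finite R M →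
    ∀ (N : Type u) [AddCommGroup N] [Module R N], Module.Finite R N →
      (∃ i₀ : ℕ, ∀ i ≥ i₀, Subsingleton (extGrp R i M N)) →
      ∀ i > b, Subsingleton (extGrp R i M N)

/-- A finitely generated module `C` is semidualizing if the homothety map
`R → Hom_R(C,C)` is bijective and `Ext^i_R(C,C) = 0` for all `i ≥ 1`. -/
def IsSemidualizing (R : Type u) [CommRing R]
    (C : Type u) [AddCommGroup C] [Module R C] : Prop :=
  Module.Finite R C ∧ Function.Bijective ⇑(LinearMap.lsmul R C) ∧
    ∀ i : ℕ, 1 ≤ i → Subsingleton (extGrp R i C C)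

/-- A module has finite injective dimension iff some `n` bounds the degrees of all
nonvanishing `Ext^i_R(-, C)`. -/
def HasFiniteInjDim (R : Type u) [CommRing R]
    (C : Type u) [AddCommGroup C] [Module R C] : Prop :=
  ∃ n : ℕ, ∀ (M : Type u) [AddCommGroup M] [Module R M],
    ∀ i > n, Subsingleton (extGrp R i M C)

/-- A dualizing module is a semidualizing module of finite injective dimension. -/
def IsDualizingModule (R : Type u) [CommRing R]
    (C : Type u) [AddCommGroup C] [Module R C] : Prop :=
  IsSemidualizing R C ∧ HasFiniteInjDim R C

/-- A local ring is Gorenstein iff it has finite injective dimension over itself. -/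
def IsGorensteinLocal (R : Type u) [CommRing R] [IsLocalRing R] : Prop :=
  HasFiniteInjDim R R

/-- An indecomposable module. -/
def IsIndecomposableMod (R : Type u) [CommRing R]
    (M : Type u) [AddCommGroup M] [Module R M] : Prop :=
  ¬ Subsingleton M ∧ ∀ N₁ N₂ : Submodule R M, IsCompl N₁ N₂ → N₁ = ⊥ ∨ N₂ = ⊥

/-- A maximal Cohen-Macaulay module: `depth_R M = dim R`. -/
def IsMCM (R : Type u) [CommRing R] [IsLocalRing R]
    (M : Type u) [AddCommGroup M] [Module R M] : Prop :=
  Module.Finite R M ∧ (moduleDepth R M : WithBot ℕ∞) = ringKrullDim R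

/-- A local ring has finite Cohen-Macaulay type if there are only finitely many
isomorphism classes of indecomposable maximal Cohen-Macaulay modules. -/
def HasFiniteCMType (R : Type u) [CommRing R] [IsLocalRing R] : Prop :=
  ∃ L : List (ModuleCat.{u} R), ∀ M : ModuleCat.{u} R,
    IsMCM R M → IsIndecomposableMod R M → ∃ N ∈ L, Nonempty (M ≅ N)

/-- A local ring is analytically unramified if its completion is reduced. -/
def IsAnalyticallyUnramified (R : Type u) [CommRing R] [IsLocalRing R] : Prop :=
  IsReduced (AdicCompletion (maximalIdeal R) R)

/-- `R` is (isomorphic to) the completion of a local ring essentially of finite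
type over `k`. -/
def IsCompletionOfEssFiniteType (k : Type u) [Field k] (R : Type u) [CommRing R]
    [Algebra k R] : Prop :=
  ∃ (A : Type u) (_ : CommRing A) (_ : IsLocalRing A) (_ : Algebra k A),
    Algebra.EssFiniteType k A ∧
      Nonempty (R ≃+* AdicCompletion (maximalIdeal A) A)

/-- The fiber product `S ×_k T` of two local rings along surjections onto their
common residue field `k`, realized as a subring of `S × T`. -/
def fiberProduct {S T k : Type u} [CommRing S] [CommRing T] [CommRing k]
    (πS : S →+* k) (πT : T →+* k) : Subring (S × T) :=
  RingHom.eqLocus (πS.comp (RingHom.fst S T)) (πT.comp (RingHom.snd S T))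

/-- The data making `πS, πT` a (non-trivial) fiber product diagram of local rings
over their common residue field `k`. -/
def IsResidueSurjection {A k : Type u} [CommRing A] [IsLocalRing A] [Field k]
    (π : A →+* k) : Prop :=
  Function.Surjective π ∧ RingHom.ker π = maximalIdeal A

/-- `k` is algebraic over a finite field. -/
def IsAlgebraicOverFiniteField (k : Type u) [Field k] : Prop :=
  ∃ F : Subfield k, (F : Set k).Finite ∧
    ∀ x : k, ∃ f : Polynomial ↥F, f ≠ 0 ∧ Polynomial.eval₂ F.subtype x f = 0

end

section ExtComparison

open CategoryTheory.Limits

variable {R : Type u} [CommRing R]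

theorem subsingleton_extGrp_succ_iff (M N : Type u) [AddCommGroup M] [Module R M]
    [AddCommGroup N] [Module R N] (n : ℕ) :
    Subsingleton (extGrp R (n + 1) M N) ↔
      Subsingleton (Abelian.Ext (ModuleCat.of R M) (ModuleCat.of R N) (n + 1)) := by
  let P := projectiveResolution (ModuleCat.of R M)
  have h₁ : Subsingleton (extGrp R (n + 1) M N) ↔
      ∀ f : P.complex.X (n + 1) ⟶ ModuleCat.of R N, P.complex.d (n + 2) (n + 1) ≫ f = 0 →
        ∃ g, P.complex.d (n + 1) n ≫ g = f := by
    rw [← ModuleCat.isZero_iff_subsingleton, extGrp, (P.isoExt (n + 1) _).isZero_iff,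
      ← HomologicalComplex.exactAt_iff_isZero_homology,
      HomologicalComplex.exactAt_iff' _ n (n + 1) (n + 2) (by simp) (by simp),
      ShortComplex.moduleCat_exact_iff]
    rfl
  have h₂ : Subsingleton (Abelian.Ext (ModuleCat.of R M) (ModuleCat.of R N) (n + 1)) ↔
      ∀ f : P.complex.X (n + 1) ⟶ ModuleCat.of R N, P.complex.d (n + 2) (n + 1) ≫ f = 0 →
        ∃ g, P.complex.d (n + 1) n ≫ g = f := by
    constructor
    · intro h f hf
      exact (P.extMk_eq_zero_iff f (n + 2) rfl hf n rfl).1 (Subsingleton.elim _ _)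
    · intro h
      refine subsingleton_of_forall_eq 0 fun α ↦ ?_
      obtain ⟨f, hf, rfl⟩ := P.extMk_surjective α (n + 2) rfl
      exact (P.extMk_eq_zero_iff f (n + 2) rfl hf n rfl).2 (h f hf)
  rw [h₁, h₂]

theorem subsingleton_extGrp_zero_iff (M N : Type u) [AddCommGroup M] [Module R M]
    [AddCommGroup N] [Module R N] :
    Subsingleton (extGrp R 0 M N) ↔ ∀ f : M →ₗ[R] N, f = 0 := by
  let P := projectiveResolution (ModuleCat.of R M)
  have h₁ : Subsingleton (extGrp R 0 M N) ↔
      ∀ f : P.complex.X 0 ⟶ ModuleCat.of R N, P.complex.d 1 0 ≫ f = 0 → f = 0 := by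
    rw [← ModuleCat.isZero_iff_subsingleton, extGrp, (P.isoExt 0 _).isZero_iff,
      ← HomologicalComplex.exactAt_iff_isZero_homology,
      HomologicalComplex.exactAt_iff' _ 0 0 1 (by simp) (by simp),
      ShortComplex.moduleCat_exact_iff]
    have hd : (P.complex.linearYonedaObj R (ModuleCat.of R N)).d 0 0 = 0 :=
      HomologicalComplex.shape _ _ _ (by simp)
    constructor
    · intro h f hf
      obtain ⟨g, hg⟩ := h f hf
      rw [← hg]
      change (P.complex.linearYonedaObj R (ModuleCat.of R N)).d 0 0 g = 0
      rw [hd]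
      rfl
    · intro h f hf
      exact ⟨0, (map_zero _).trans (h f hf).symm⟩
  rw [h₁]
  constructor
  · intro h f
    let f' : ((ChainComplex.single₀ (ModuleCat.{u} R)).obj (ModuleCat.of R M)).X 0 ⟶
      ModuleCat.of R N := ModuleCat.ofHom f
    have hf := h (P.π.f 0 ≫ f') (by
      rw [← Category.assoc, P.complex_d_comp_π_f_zero, zero_comp])
    have : f' = 0 := by rw [← cancel_epi (P.π.f 0), hf, comp_zero]
    exact congrArg ModuleCat.Hom.hom this
  · intro h f hf
    let g := P.exact₀.desc f hf
    have hg : P.π.f 0 ≫ g = f := P.exact₀.g_desc f hf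
    have hg' : g.hom = 0 := h g.hom
    rw [← hg, ModuleCat.hom_ext (f := g) (g := 0) hg', comp_zero]

end ExtComparison

section ExtVanishing

open Abelian

variable {R : Type u} [CommRing R] {A B C : Type u} [AddCommGroup A] [Module R A]
  [AddCommGroup B] [Module R B] [AddCommGroup C] [Module R C]

/-- The short exact sequence of modules attached to an exact pair of linear maps. -/
theorem shortExact_of_exact {f : A →ₗ[R] B} {g : B →ₗ[R] C} (hf : Function.Injective f)
    (hg : Function.Surjective g) (hfg : Function.Exact f g) :
    (ShortComplex.mk (ModuleCat.ofHom f) (ModuleCat.ofHom g) (by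
      rw [← ModuleCat.ofHom_comp, hfg.linearMap_comp_eq_zero]; rfl)).ShortExact where
  exact := by
    rw [ShortComplex.ShortExact.moduleCat_exact_iff_function_exact]
    exact hfg
  mono_f := (ModuleCat.mono_iff_injective _).2 hf
  epi_g := (ModuleCat.epi_iff_surjective _).2 hg

variable {N : Type u} [AddCommGroup N] [Module R N]

theorem exists_extension_of_subsingleton_ext_one {f : A →ₗ[R] B} {g : B →ₗ[R] C}
    (hf : Function.Injective f) (hg : Function.Surjective g) (hfg : Function.Exact f g)
    (hC : Subsingleton (Ext (ModuleCat.of R C) (ModuleCat.of R N) 1)) (h : A →ₗ[R] N) :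
    ∃ h' : B →ₗ[R] N, h' ∘ₗ f = h := by
  obtain ⟨φ, hφ⟩ := Ext.contravariant_sequence_exact₁ (shortExact_of_exact hf hg hfg) _
    (Ext.mk₀ (ModuleCat.ofHom h)) (zero_add 1) (Subsingleton.elim _ _)
  obtain ⟨φ, rfl⟩ := Ext.homEquiv₀.symm.surjective φ
  refine ⟨φ.hom, ?_⟩
  rw [Ext.homEquiv₀_symm_apply, Ext.mk₀_comp_mk₀] at hφ
  exact congrArg ModuleCat.Hom.hom ((Ext.mk₀_bijective _ _).1 hφ)

theorem subsingleton_ext_one_of_extension [Module.Projective R B] {f : A →ₗ[R] B}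
    {g : B →ₗ[R] C} (hf : Function.Injective f) (hg : Function.Surjective g)
    (hfg : Function.Exact f g) (H : ∀ h : A →ₗ[R] N, ∃ h' : B →ₗ[R] N, h' ∘ₗ f = h) :
    Subsingleton (Ext (ModuleCat.of R C) (ModuleCat.of R N) 1) := by
  have hS := shortExact_of_exact hf hg hfg
  refine subsingleton_of_forall_eq 0 fun x ↦ ?_
  obtain ⟨y, rfl⟩ := Ext.contravariant_sequence_exact₃ hS _ x
    (Ext.eq_zero_of_projective (P := ModuleCat.of R B) _) (add_zero 1)
  obtain ⟨φ, rfl⟩ := Ext.homEquiv₀.symm.surjective y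
  obtain ⟨h', hh'⟩ := H φ.hom
  have : φ = ModuleCat.ofHom f ≫ ModuleCat.ofHom h' := ModuleCat.hom_ext hh'.symm
  rw [Ext.homEquiv₀_symm_apply, this, ← Ext.mk₀_comp_mk₀, ← Ext.comp_assoc_of_second_deg_zero]
  have h0 : hS.extClass.comp (Ext.mk₀ (ModuleCat.ofHom f)) (add_zero 1) = 0 :=
    hS.extClass_comp
  rw [h0, Ext.zero_comp]

theorem subsingleton_ext_left_of_right [Module.Projective R B] {f : A →ₗ[R] B}
    {g : B →ₗ[R] C} (hf : Function.Injective f) (hg : Function.Surjective g)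
    (hfg : Function.Exact f g) (n : ℕ)
    (h : Subsingleton (Ext (ModuleCat.of R C) (ModuleCat.of R N) (n + 2))) :
    Subsingleton (Ext (ModuleCat.of R A) (ModuleCat.of R N) (n + 1)) := by
  have hS := shortExact_of_exact hf hg hfg
  refine subsingleton_of_forall_eq 0 fun x ↦ ?_
  obtain ⟨y, rfl⟩ := Ext.contravariant_sequence_exact₁ hS _ x
    (n₁ := n + 2) (by lia) (Subsingleton.elim _ _)
  rw [Ext.eq_zero_of_projective (P := ModuleCat.of R B) y, Ext.comp_zero]

theorem subsingleton_ext_right_of_left [Module.Projective R B] {f : A →ₗ[R] B}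
    {g : B →ₗ[R] C} (hf : Function.Injective f) (hg : Function.Surjective g)
    (hfg : Function.Exact f g) (n : ℕ)
    (h : Subsingleton (Ext (ModuleCat.of R A) (ModuleCat.of R N) (n + 1))) :
    Subsingleton (Ext (ModuleCat.of R C) (ModuleCat.of R N) (n + 2)) := by
  have hS := shortExact_of_exact hf hg hfg
  refine subsingleton_of_forall_eq 0 fun x ↦ ?_
  obtain ⟨y, rfl⟩ := Ext.contravariant_sequence_exact₃ hS _ x
    (Ext.eq_zero_of_projective (P := ModuleCat.of R B) _) (n₀ := n + 1) (by lia)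
  rw [Subsingleton.elim y 0, Ext.comp_zero]

theorem subsingleton_ext_middle {f : A →ₗ[R] B}
    {g : B →ₗ[R] C} (hf : Function.Injective f) (hg : Function.Surjective g)
    (hfg : Function.Exact f g) (n : ℕ)
    (hA : Subsingleton (Ext (ModuleCat.of R A) (ModuleCat.of R N) n))
    (hC : Subsingleton (Ext (ModuleCat.of R C) (ModuleCat.of R N) n)) :
    Subsingleton (Ext (ModuleCat.of R B) (ModuleCat.of R N) n) := by
  have hS := shortExact_of_exact hf hg hfg
  refine subsingleton_of_forall_eq 0 fun x ↦ ?_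
  obtain ⟨y, rfl⟩ := Ext.contravariant_sequence_exact₂ hS _ x (Subsingleton.elim _ _)
  rw [Subsingleton.elim y 0, Ext.comp_zero]

theorem subsingleton_ext_of_retract (i : A →ₗ[R] B) (r : B →ₗ[R] A)
    (hri : r ∘ₗ i = LinearMap.id) (n : ℕ)
    (hB : Subsingleton (Ext (ModuleCat.of R B) (ModuleCat.of R N) n)) :
    Subsingleton (Ext (ModuleCat.of R A) (ModuleCat.of R N) n) := by
  refine subsingleton_of_forall_eq 0 fun x ↦ ?_
  have h : ModuleCat.ofHom i ≫ ModuleCat.ofHom r = 𝟙 (ModuleCat.of R A) :=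
    ModuleCat.hom_ext hri
  rw [← Ext.mk₀_id_comp x, ← h, ← Ext.mk₀_comp_mk₀, Ext.comp_assoc_of_second_deg_zero,
    Subsingleton.elim ((Ext.mk₀ (ModuleCat.ofHom r)).comp x (zero_add n)) 0, Ext.comp_zero]

end ExtVanishing

section IdealPair

variable {R : Type u} [CommRing R] {I J : Ideal R}

theorem mul_eq_zero_of_inf_eq_bot (hIJ : I ⊓ J = ⊥) {i j : R} (hi : i ∈ I) (hj : j ∈ J) :
    i * j = 0 := by
  have : i * j ∈ I ⊓ J := ⟨I.mul_mem_right _ hi, J.mul_mem_left _ hj⟩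
  rwa [hIJ, Ideal.mem_bot] at this

theorem eq_zero_of_mem_of_mem (hIJ : I ⊓ J = ⊥) {z : R} (hI : z ∈ I) (hJ : z ∈ J) : z = 0 := by
  have : z ∈ I ⊓ J := ⟨hI, hJ⟩
  rwa [hIJ, Ideal.mem_bot] at this

theorem exists_presentation {n : ℕ} {a : Fin n → R} (ha : Ideal.span (Set.range a) = J) :
    ∃ g : (Fin n → R) →ₗ[R] J, Function.Surjective g ∧
      Function.Exact (LinearMap.ker (Fintype.linearCombination R a)).subtype g := by
  have hr : LinearMap.range (Fintype.linearCombination R a) = J := by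
    rw [Fintype.range_linearCombination]
    exact ha
  refine ⟨(Fintype.linearCombination R a).codRestrict J fun v ↦ hr ▸ ⟨v, rfl⟩, ?_, ?_⟩
  · rw [← LinearMap.range_eq_top, LinearMap.range_codRestrict, hr]
    exact Submodule.comap_subtype_self _
  · rw [LinearMap.exact_iff, LinearMap.ker_codRestrict, Submodule.range_subtype]

theorem nonempty_index_of_span_eq (hI : I ≠ ⊥) {n : ℕ} {a : Fin n → R}
    (ha : Ideal.span (Set.range a) = I) : Nonempty (Fin n) := by
  by_contra h
  rw [not_nonempty_iff] at h
  exact hI (by rw [← ha, Set.range_eq_empty, Ideal.span_empty])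

end IdealPair

section DecomposableMaximalIdeal

variable {R : Type u} [CommRing R] [IsLocalRing R] {I J : Ideal R}

theorem exists_projection_of_inf_eq_bot (hIJ : I ⊓ J = ⊥) (hsup : I ⊔ J = maximalIdeal R) :
    ∃ p : maximalIdeal R →ₗ[R] J, ∀ z : maximalIdeal R, (z : R) - p z ∈ I := by
  have key : ∀ z : maximalIdeal R, ∃ j : J, (z : R) - j ∈ I := by
    rintro ⟨z, hz⟩
    rw [← hsup, Submodule.mem_sup] at hz
    obtain ⟨i, hi, j, hj, rfl⟩ := hz
    exact ⟨⟨j, hj⟩, by simpa using hi⟩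
  choose p hp using key
  have uniq : ∀ (z : maximalIdeal R) (j : J), (z : R) - j ∈ I → p z = j := by
    intro z j hj
    rw [← sub_eq_zero, ← Subtype.coe_inj]
    refine eq_zero_of_mem_of_mem hIJ ?_ (p z - j).2
    convert I.sub_mem hj (hp z) using 1
    push_cast
    ring
  refine ⟨{ toFun := p, map_add' := fun y z ↦ uniq _ _ ?_, map_smul' := fun r z ↦ uniq _ _ ?_ }, hp⟩
  · convert I.add_mem (hp y) (hp z) using 1
    push_cast
    ring
  · convert I.mul_mem_left r (hp z) using 1
    push_cast
    simp [mul_sub]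

/-- Over a local ring, every relation among the members of a shortest generating family of an
ideal has all its coefficients in the maximal ideal. -/
theorem exists_minimal_generators (hJ : J.FG) :
    ∃ (n : ℕ) (a : Fin n → R), Ideal.span (Set.range a) = J ∧
      ∀ v : Fin n → R, Fintype.linearCombination R a v = 0 → ∀ i, v i ∈ maximalIdeal R := by
  classical
  have hex : ∃ (n : ℕ) (a : Fin n → R), Ideal.span (Set.range a) = J :=
    Submodule.fg_iff_exists_fin_generating_family.1 hJ
  obtain ⟨a, ha⟩ := Nat.find_spec hex
  refine ⟨Nat.find hex, a, ha, fun v hv i ↦ ?_⟩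
  have hmin := fun m (hm : m < Nat.find hex) ↦ Nat.find_min hex hm
  generalize Nat.find hex = n at *
  obtain _ | n := n
  · exact i.elim0
  by_contra hi
  rw [mem_maximalIdeal, mem_nonunits_iff, not_not] at hi
  refine hmin n n.lt_succ_self ⟨a ∘ i.succAbove, ?_⟩
  rw [← ha]
  refine le_antisymm (Ideal.span_mono (Set.range_comp_subset_range _ _)) ?_
  rw [Ideal.span_le]
  rintro _ ⟨j, rfl⟩
  by_cases hj : j = i
  · subst hj
    rw [Fintype.linearCombination_apply, Fin.sum_univ_succAbove _ j, smul_eq_mul] at hv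
    rw [SetLike.mem_coe, ← Ideal.unit_mul_mem_iff_mem _ hi, eq_neg_of_add_eq_zero_left hv]
    refine neg_mem (sum_mem fun k _ ↦ Ideal.mul_mem_left _ _ (Ideal.subset_span ⟨k, rfl⟩))
  · obtain ⟨k, rfl⟩ := Fin.exists_succAbove_eq hj
    exact Ideal.subset_span ⟨k, rfl⟩

/-- If `a` minimally generates `I`, then `J` is a direct summand of the first syzygy of `I`. -/
theorem exists_retract_syzygy (hIJ : I ⊓ J = ⊥) (hsup : I ⊔ J = maximalIdeal R)
    {n : ℕ} {a : Fin n → R} (ha : Ideal.span (Set.range a) = I)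
    (hmin : ∀ v : Fin n → R, Fintype.linearCombination R a v = 0 → ∀ i, v i ∈ maximalIdeal R)
    (i : Fin n) :
    ∃ (s : J →ₗ[R] LinearMap.ker (Fintype.linearCombination R a))
      (r : LinearMap.ker (Fintype.linearCombination R a) →ₗ[R] J),
      r ∘ₗ s = LinearMap.id ∧ ∀ j, (s j : Fin n → R) = Pi.single i (j : R) := by
  obtain ⟨p, hp⟩ := exists_projection_of_inf_eq_bot hIJ hsup
  refine ⟨((LinearMap.single R (fun _ ↦ R) i) ∘ₗ J.subtype).codRestrict _ fun j ↦ ?_,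
    p ∘ₗ ((LinearMap.proj i) ∘ₗ Submodule.subtype _).codRestrict (maximalIdeal R)
      fun v ↦ hmin _ v.2 i, ?_, fun j ↦ rfl⟩
  · have hai : a i ∈ I := ha ▸ Ideal.subset_span ⟨i, rfl⟩
    simp [Fintype.linearCombination_apply_single, mul_comm (j : R),
      mul_eq_zero_of_inf_eq_bot hIJ hai j.2]
  · ext j
    have hj : (j : R) ∈ maximalIdeal R := hsup ▸ (le_sup_right : J ≤ I ⊔ J) j.2
    have h := hp ⟨j, hj⟩
    have : p ⟨j, hj⟩ = j := by
      rw [eq_comm, ← sub_eq_zero, ← Subtype.coe_inj]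
      exact eq_zero_of_mem_of_mem hIJ h (j - p ⟨j, hj⟩).2
    simp only [LinearMap.comp_apply, LinearMap.id_apply]
    convert congrArg Subtype.val this using 3
    ext
    exact Pi.single_eq_same (M := fun _ ↦ R) i (j : R)

theorem subsingleton_ext_other_summand [IsNoetherianRing R] (hI : I ≠ ⊥) (hIJ : I ⊓ J = ⊥)
    (hsup : I ⊔ J = maximalIdeal R) (n : ℕ)
    (h : Subsingleton (Abelian.Ext (ModuleCat.of R I) (ModuleCat.of R R) (n + 2))) :
    Subsingleton (Abelian.Ext (ModuleCat.of R J) (ModuleCat.of R R) (n + 1)) := by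
  obtain ⟨m, a, ha, hmin⟩ := exists_minimal_generators (IsNoetherian.noetherian I)
  obtain ⟨i⟩ := nonempty_index_of_span_eq hI ha
  obtain ⟨g, hg, hfg⟩ := exists_presentation ha
  obtain ⟨s, r, hrs, -⟩ := exists_retract_syzygy hIJ hsup ha hmin i
  exact subsingleton_ext_of_retract s r hrs _
    (subsingleton_ext_left_of_right (Submodule.subtype_injective _) hg hfg n h)

theorem subsingleton_ext_one_summands [IsNoetherianRing R] (hI : I ≠ ⊥) (hJ : J ≠ ⊥)
    (hIJ : I ⊓ J = ⊥) (hsup : I ⊔ J = maximalIdeal R) (hR : IsGorensteinLocal R) :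
    Subsingleton (Abelian.Ext (ModuleCat.of R I) (ModuleCat.of R R) 1) ∧
    Subsingleton (Abelian.Ext (ModuleCat.of R J) (ModuleCat.of R R) 1) := by
  obtain ⟨n, hn⟩ := hR
  have hJI : J ⊓ I = ⊥ := by rwa [inf_comm]
  have hsup' : J ⊔ I = maximalIdeal R := by rwa [sup_comm]
  suffices ∀ m, Subsingleton (Abelian.Ext (ModuleCat.of R I) (ModuleCat.of R R) (m + 1)) →
      Subsingleton (Abelian.Ext (ModuleCat.of R J) (ModuleCat.of R R) (m + 1)) →
      Subsingleton (Abelian.Ext (ModuleCat.of R I) (ModuleCat.of R R) 1) ∧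
      Subsingleton (Abelian.Ext (ModuleCat.of R J) (ModuleCat.of R R) 1) from
    this n ((subsingleton_extGrp_succ_iff _ _ _).1 (hn I (n + 1) n.lt_succ_self))
      ((subsingleton_extGrp_succ_iff _ _ _).1 (hn J (n + 1) n.lt_succ_self))
  intro m
  induction m with
  | zero => exact fun h₁ h₂ ↦ ⟨h₁, h₂⟩
  | succ m ih =>
    exact fun h₁ h₂ ↦ ih (subsingleton_ext_other_summand hJ hJI hsup' m h₂)
      (subsingleton_ext_other_summand hI hIJ hsup m h₁)

theorem exists_eq_mul_of_subsingleton_ext [IsNoetherianRing R] (hI : I ≠ ⊥) (hIJ : I ⊓ J = ⊥)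
    (hsup : I ⊔ J = maximalIdeal R)
    (h : Subsingleton (Abelian.Ext (ModuleCat.of R I) (ModuleCat.of R R) 1)) (f : J →ₗ[R] R) :
    ∃ c : R, ∀ j, f j = j * c := by
  obtain ⟨m, a, ha, hmin⟩ := exists_minimal_generators (IsNoetherian.noetherian I)
  obtain ⟨i⟩ := nonempty_index_of_span_eq hI ha
  obtain ⟨g, hg, hfg⟩ := exists_presentation ha
  obtain ⟨s, r, hrs, hs⟩ := exists_retract_syzygy hIJ hsup ha hmin i
  obtain ⟨F, hF⟩ := exists_extension_of_subsingleton_ext_one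
    (Submodule.subtype_injective _) hg hfg h (f ∘ₗ r)
  refine ⟨F (Pi.single i 1), fun j ↦ ?_⟩
  have h₁ : f j = F (s j) := by
    have h₂ := LinearMap.congr_fun hF (s j)
    have h₃ := LinearMap.congr_fun hrs j
    simp only [LinearMap.comp_apply, LinearMap.id_apply] at h₂ h₃
    rw [h₃] at h₂
    exact h₂.symm
  rw [h₁, hs, ← smul_eq_mul, ← map_smul, ← Pi.single_smul, smul_eq_mul, mul_one]

theorem eq_zero_of_forall_exists_eq_mul [IsNoetherianRing R] (hJ : J ≠ ⊥) (hIJ : I ⊓ J = ⊥)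
    (h : ∀ f : J →ₗ[R] R, ∃ c : R, ∀ j, f j = j * c) {s : R} (hsI : s ∈ I)
    (hs : ∀ z ∈ maximalIdeal R, z * s = 0) : s = 0 := by
  obtain ⟨n, a, ha, hmin⟩ := exists_minimal_generators (IsNoetherian.noetherian J)
  obtain ⟨i⟩ := nonempty_index_of_span_eq hJ ha
  obtain ⟨g, hg, hfg⟩ := exists_presentation ha
  let φ : (Fin n → R) →ₗ[R] R := (LinearMap.toSpanSingleton R R s) ∘ₗ LinearMap.proj i
  have hφ : LinearMap.ker g ≤ LinearMap.ker φ := by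
    intro v hv
    obtain ⟨w, rfl⟩ := (hfg v).1 hv
    exact hs _ (hmin _ w.2 i)
  let f : J →ₗ[R] R :=
    (LinearMap.ker g).liftQ φ hφ ∘ₗ (g.quotKerEquivOfSurjective hg).symm.toLinearMap
  have hf : f (g (Pi.single i 1)) = s := by
    have : (g.quotKerEquivOfSurjective hg).symm (g (Pi.single i 1)) =
        Submodule.Quotient.mk (Pi.single i 1) := by
      rw [LinearEquiv.symm_apply_eq]
      rfl
    simp only [f, LinearMap.comp_apply, LinearEquiv.coe_coe, this]
    simp [φ]
  obtain ⟨c, hc⟩ := h f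
  refine eq_zero_of_mem_of_mem hIJ hsI ?_
  rw [← hf, hc]
  exact J.mul_mem_right _ (Subtype.prop _)

theorem eq_zero_of_forall_mul_eq_zero [IsNoetherianRing R] (hI : I ≠ ⊥) (hJ : J ≠ ⊥)
    (hIJ : I ⊓ J = ⊥) (hsup : I ⊔ J = maximalIdeal R)
    (hextI : Subsingleton (Abelian.Ext (ModuleCat.of R I) (ModuleCat.of R R) 1))
    (hextJ : Subsingleton (Abelian.Ext (ModuleCat.of R J) (ModuleCat.of R R) 1))
    {s : R} (hs : ∀ z ∈ maximalIdeal R, z * s = 0) : s = 0 := by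
  have hJI : J ⊓ I = ⊥ := by rwa [inf_comm]
  have hsup' : J ⊔ I = maximalIdeal R := by rwa [sup_comm]
  have hsm : s ∈ maximalIdeal R := by
    by_contra hu
    rw [mem_maximalIdeal, mem_nonunits_iff, not_not] at hu
    refine hI (eq_bot_iff.2 fun z hz ↦ ?_)
    exact hu.mul_left_eq_zero.1 (hs z (hsup ▸ (le_sup_left : I ≤ I ⊔ J) hz))
  rw [← hsup, Submodule.mem_sup] at hsm
  obtain ⟨i, hi, j, hj, rfl⟩ := hsm
  have hi0 : i = 0 := by
    refine eq_zero_of_forall_exists_eq_mul hJ hIJ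
      (exists_eq_mul_of_subsingleton_ext hI hIJ hsup hextI) hi fun z hz ↦ ?_
    have h₁ := hs z hz
    refine eq_zero_of_mem_of_mem hIJ (I.mul_mem_left _ hi) ?_
    rw [mul_add] at h₁
    rw [eq_neg_of_add_eq_zero_left h₁]
    exact neg_mem (J.mul_mem_left _ hj)
  have hj0 : j = 0 := by
    refine eq_zero_of_forall_exists_eq_mul hI hJI
      (exists_eq_mul_of_subsingleton_ext hJ hJI hsup' hextJ) hj fun z hz ↦ ?_
    simpa [hi0] using hs z hz
  rw [hi0, hj0, add_zero]

/-- The relations with coefficients in `J` among minimal generators of `J` vanish as soon as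
`Ext¹(J, R) = 0`. -/
theorem eq_zero_of_linearCombination_eq_zero [IsNoetherianRing R] (hI : I ≠ ⊥)
    (hIJ : I ⊓ J = ⊥) (hsup : I ⊔ J = maximalIdeal R)
    (hextJ : Subsingleton (Abelian.Ext (ModuleCat.of R J) (ModuleCat.of R R) 1))
    {n : ℕ} {a : Fin n → R} (ha : Ideal.span (Set.range a) = J)
    (hmin : ∀ v : Fin n → R, Fintype.linearCombination R a v = 0 → ∀ i, v i ∈ maximalIdeal R)
    {v : Fin n → R} (hv : Fintype.linearCombination R a v = 0) (hvJ : ∀ i, v i ∈ J) : v = 0 := by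
  obtain ⟨g, hg, hfg⟩ := exists_presentation ha
  obtain ⟨p, hp⟩ := exists_projection_of_inf_eq_bot hIJ hsup
  have haJ : ∀ i, a i ∈ J := fun i ↦ ha ▸ Ideal.subset_span ⟨i, rfl⟩
  let K := LinearMap.ker (Fintype.linearCombination R a)
  let Z : Submodule R (Fin n → R) := K ⊓ Submodule.pi Set.univ fun _ ↦ J
  let P : Fin n → Z →ₗ[R] R := fun i ↦ LinearMap.proj i ∘ₗ Z.subtype
  let q : K →ₗ[R] (Fin n → R) := LinearMap.pi fun i ↦ J.subtype ∘ₗ p ∘ₗ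
    ((LinearMap.proj i) ∘ₗ Submodule.subtype _).codRestrict (maximalIdeal R)
      fun v ↦ hmin _ v.2 i
  have hqI : ∀ (w : K) i, (w : Fin n → R) i - q w i ∈ I := fun w i ↦ hp ⟨w.1 i, hmin _ w.2 i⟩
  have hqJ : ∀ (w : K) i, q w i ∈ J := fun w i ↦ (p ⟨w.1 i, hmin _ w.2 i⟩).2
  have hqZ : ∀ w, q w ∈ Z := by
    intro w
    refine ⟨?_, fun i _ ↦ hqJ w i⟩
    have hw : Fintype.linearCombination R a w = 0 := w.2
    change Fintype.linearCombination R a (q w) = 0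
    rw [← hw, Fintype.linearCombination_apply, Fintype.linearCombination_apply]
    refine Finset.sum_congr rfl fun i _ ↦ ?_
    rw [eq_comm, ← sub_eq_zero, ← sub_smul]
    exact mul_eq_zero_of_inf_eq_bot hIJ (hqI w i) (haJ i)
  have hqid : ∀ w : Z, q ⟨w, w.2.1⟩ = w := by
    intro w
    ext i
    rw [eq_comm, ← sub_eq_zero]
    exact eq_zero_of_mem_of_mem hIJ (hqI ⟨w, w.2.1⟩ i)
      (J.sub_mem (w.2.2 i trivial) (hqJ _ i))
  have hspan : ∀ f : Z →ₗ[R] R, ∃ c : Fin n → R, (∀ i, c i ∈ maximalIdeal R) ∧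
      f = ∑ i, c i • P i := by
    intro f
    obtain ⟨F, hF⟩ := exists_extension_of_subsingleton_ext_one
      (Submodule.subtype_injective _) hg hfg hextJ (f ∘ₗ q.codRestrict Z hqZ)
    refine ⟨fun i ↦ F (Pi.single i 1), fun i ↦ ?_, ?_⟩
    · by_contra hu
      rw [mem_maximalIdeal, mem_nonunits_iff, not_not] at hu
      refine hI (eq_bot_iff.2 fun z hz ↦ ?_)
      have hzK : Pi.single i z ∈ K := by
        simp [K, Fintype.linearCombination_apply_single,
          mul_eq_zero_of_inf_eq_bot hIJ hz (haJ i)]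
      have hqz : q ⟨_, hzK⟩ = 0 := by
        ext k
        refine eq_zero_of_mem_of_mem hIJ ?_ (hqJ _ k)
        have h₁ : (Pi.single i z : Fin n → R) k ∈ I := by
          by_cases hk : k = i
          · subst hk
            simpa using hz
          · simp [hk]
        simpa using I.sub_mem h₁ (hqI ⟨_, hzK⟩ k)
      have h₂ : F (Pi.single i z) = 0 := by
        have h₃ := LinearMap.congr_fun hF ⟨_, hzK⟩
        have h₄ : q.codRestrict Z hqZ ⟨_, hzK⟩ = 0 := Subtype.ext hqz
        simpa [h₄] using h₃
      have h₅ : z * F (Pi.single i 1) = 0 := by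
        rw [← h₂, ← smul_eq_mul, ← map_smul, ← Pi.single_smul, smul_eq_mul, mul_one]
      exact hu.mul_left_eq_zero.1 h₅
    · ext w
      have h₁ : f w = F w := by
        have h₂ := LinearMap.congr_fun hF ⟨w, w.2.1⟩
        have h₃ : q.codRestrict Z hqZ ⟨w, w.2.1⟩ = w := Subtype.ext (hqid w)
        simp only [LinearMap.comp_apply, h₃] at h₂
        exact h₂.symm
      rw [h₁]
      conv_lhs => rw [pi_eq_sum_univ' (w : Fin n → R)]
      simp [P, mul_comm]
  have hbot : (⊤ : Submodule R (Z →ₗ[R] R)) = ⊥ := by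
    refine Submodule.eq_bot_of_le_smul_of_le_jacobson_bot (maximalIdeal R) _ ?_ ?_
      (maximalIdeal_le_jacobson _)
    · have : ⊤ = Submodule.span R (Set.range P) := by
        refine (eq_top_iff.2 fun f _ ↦ ?_).symm
        obtain ⟨c, -, rfl⟩ := hspan f
        exact sum_mem fun i _ ↦ Submodule.smul_mem _ _ (Submodule.subset_span ⟨i, rfl⟩)
      rw [this]
      exact Submodule.fg_span (Set.finite_range P)
    · intro f _
      obtain ⟨c, hc, rfl⟩ := hspan f
      exact sum_mem fun i _ ↦ Submodule.smul_mem_smul (hc i) trivial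
  ext i
  have hPi : P i = 0 := by
    have : P i ∈ (⊤ : Submodule R (Z →ₗ[R] R)) := trivial
    rwa [hbot, Submodule.mem_bot] at this
  exact LinearMap.congr_fun hPi ⟨v, hv, fun i _ ↦ hvJ i⟩

theorem exists_eq_span_singleton_of_subsingleton_ext [IsNoetherianRing R] (hI : I ≠ ⊥)
    (hJ : J ≠ ⊥) (hIJ : I ⊓ J = ⊥) (hsup : I ⊔ J = maximalIdeal R)
    (hextJ : Subsingleton (Abelian.Ext (ModuleCat.of R J) (ModuleCat.of R R) 1)) :
    ∃ y, J = Ideal.span {y} := by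
  obtain ⟨n, a, ha, hmin⟩ := exists_minimal_generators (IsNoetherian.noetherian J)
  obtain ⟨i⟩ := nonempty_index_of_span_eq hJ ha
  have haJ : ∀ i, a i ∈ J := fun i ↦ ha ▸ Ideal.subset_span ⟨i, rfl⟩
  have hne : ∀ k, a k ≠ 0 := by
    intro k hk
    have := hmin (Pi.single k 1) (by simp [Fintype.linearCombination_apply_single, hk]) k
    simp at this
  refine ⟨a i, le_antisymm ?_ ((Ideal.span_singleton_le_iff_mem _).2 (haJ i))⟩
  rw [← ha, Ideal.span_le]
  rintro _ ⟨k, rfl⟩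
  by_cases hk : k = i
  · subst hk
    exact Ideal.mem_span_singleton_self _
  · exfalso
    have hv := eq_zero_of_linearCombination_eq_zero hI hIJ hsup hextJ ha hmin
      (v := Pi.single k (a i) - Pi.single i (a k))
      (by simp [Fintype.linearCombination_apply_single, mul_comm]) (fun l ↦ by
        refine J.sub_mem ?_ ?_
        · by_cases hl : l = k
          · subst hl
            simpa using haJ i
          · simp [hl]
        · by_cases hl : l = i
          · subst hl
            simpa using haJ k
          · simp [hl])
    have := congrFun hv k
    simp [hk] at this
    exact hne i this

end DecomposableMaximalIdeal

/-- The elements `x` and `y` present the maximal ideal of a local ring as a direct sum of two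
principal ideals which are the annihilators of each other. -/
structure IsNodalPair {R : Type u} [CommRing R] [IsLocalRing R] (x y : R) : Prop where
  left_ne_zero : x ≠ 0
  right_ne_zero : y ≠ 0
  sup_eq : Ideal.span {x} ⊔ Ideal.span {y} = maximalIdeal R
  inf_eq : Ideal.span {x} ⊓ Ideal.span {y} = ⊥
  mem_of_mul_left_eq_zero : ∀ c, c * x = 0 → c ∈ Ideal.span {y}
  mem_of_mul_right_eq_zero : ∀ c, c * y = 0 → c ∈ Ideal.span {x}

section NodalPair

variable {R : Type u} [CommRing R] [IsLocalRing R] {x y : R}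

theorem mem_span_of_mul_eq_zero (hx : x ≠ 0)
    (hsup : Ideal.span {x} ⊔ Ideal.span {y} = maximalIdeal R)
    (hinf : Ideal.span {x} ⊓ Ideal.span {y} = ⊥)
    (hsoc : ∀ s : R, (∀ z ∈ maximalIdeal R, z * s = 0) → s = 0) {c : R} (hc : c * x = 0) :
    c ∈ Ideal.span {y} := by
  have hxy : x * y = 0 := mul_eq_zero_of_inf_eq_bot hinf
    (Ideal.mem_span_singleton_self x) (Ideal.mem_span_singleton_self y)
  have hcm : c ∈ maximalIdeal R := by
    rw [mem_maximalIdeal, mem_nonunits_iff]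
    exact fun hu ↦ hx (hu.mul_right_eq_zero.1 hc)
  rw [← hsup, Ideal.mem_span_singleton_sup] at hcm
  obtain ⟨r, j, hj, rfl⟩ := hcm
  obtain ⟨t, rfl⟩ := Ideal.mem_span_singleton'.1 hj
  have hrx : r * x = 0 := by
    refine hsoc _ fun z hz ↦ ?_
    rw [← hsup, Ideal.mem_span_singleton_sup] at hz
    obtain ⟨a, b, hb, rfl⟩ := hz
    obtain ⟨b, rfl⟩ := Ideal.mem_span_singleton'.1 hb
    linear_combination a * hc + (b * r - a * t) * hxy
  rwa [hrx, zero_add]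

theorem isNodalPair_of_socle_eq_bot (hx : x ≠ 0) (hy : y ≠ 0)
    (hsup : Ideal.span {x} ⊔ Ideal.span {y} = maximalIdeal R)
    (hinf : Ideal.span {x} ⊓ Ideal.span {y} = ⊥)
    (hsoc : ∀ s : R, (∀ z ∈ maximalIdeal R, z * s = 0) → s = 0) : IsNodalPair x y where
  left_ne_zero := hx
  right_ne_zero := hy
  sup_eq := hsup
  inf_eq := hinf
  mem_of_mul_left_eq_zero _ := mem_span_of_mul_eq_zero hx hsup hinf hsoc
  mem_of_mul_right_eq_zero _ := mem_span_of_mul_eq_zero hy (by rwa [sup_comm])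
    (by rwa [inf_comm]) hsoc

theorem exists_isNodalPair_of_isGorensteinLocal [IsNoetherianRing R]
    (hdec : HasDecomposableMaxIdeal R) (hR : IsGorensteinLocal R) :
    ∃ x y : R, IsNodalPair x y := by
  obtain ⟨I, J, hI, hJ, hIJ, hsup⟩ := hdec
  obtain ⟨hextI, hextJ⟩ := subsingleton_ext_one_summands hI hJ hIJ hsup hR
  obtain ⟨y, rfl⟩ := exists_eq_span_singleton_of_subsingleton_ext hI hJ hIJ hsup hextJ
  obtain ⟨x, rfl⟩ := exists_eq_span_singleton_of_subsingleton_ext hJ hI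
    (by rwa [inf_comm]) (by rwa [sup_comm]) hextI
  rw [Ne, Ideal.span_singleton_eq_bot] at hI hJ
  exact ⟨x, y, isNodalPair_of_socle_eq_bot hI hJ hsup hIJ fun s hs ↦
    eq_zero_of_forall_mul_eq_zero (by simpa using hI) (by simpa using hJ) hIJ hsup
      hextI hextJ hs⟩

namespace IsNodalPair

theorem symm (h : IsNodalPair x y) : IsNodalPair y x where
  left_ne_zero := h.right_ne_zero
  right_ne_zero := h.left_ne_zero
  sup_eq := by rw [sup_comm, h.sup_eq]
  inf_eq := by rw [inf_comm, h.inf_eq]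
  mem_of_mul_left_eq_zero := h.mem_of_mul_right_eq_zero
  mem_of_mul_right_eq_zero := h.mem_of_mul_left_eq_zero

theorem mul_eq_zero (h : IsNodalPair x y) : x * y = 0 :=
  mul_eq_zero_of_inf_eq_bot h.inf_eq (Ideal.mem_span_singleton_self x)
    (Ideal.mem_span_singleton_self y)

theorem left_mem (h : IsNodalPair x y) : x ∈ maximalIdeal R :=
  h.sup_eq ▸ Ideal.mem_sup_left (Ideal.mem_span_singleton_self x)

theorem right_mem (h : IsNodalPair x y) : y ∈ maximalIdeal R := h.symm.left_mem

theorem mem_maximalIdeal_iff (h : IsNodalPair x y) {z : R} :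
    z ∈ maximalIdeal R ↔ ∃ a b, a * x + b * y = z := by
  rw [← h.sup_eq, ← Ideal.span_union, Set.singleton_union, Ideal.mem_span_pair]

theorem hasDecomposableMaxIdeal (h : IsNodalPair x y) : HasDecomposableMaxIdeal R :=
  ⟨Ideal.span {x}, Ideal.span {y}, by simpa using h.left_ne_zero,
    by simpa using h.right_ne_zero, h.inf_eq, h.sup_eq⟩

theorem eq_zero_of_forall_mul_eq_zero (h : IsNodalPair x y) {s : R}
    (hs : ∀ z ∈ maximalIdeal R, z * s = 0) : s = 0 :=
  eq_zero_of_mem_of_mem h.inf_eq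
    (h.mem_of_mul_right_eq_zero _ (by rw [mul_comm, hs y h.right_mem]))
    (h.mem_of_mul_left_eq_zero _ (by rw [mul_comm, hs x h.left_mem]))

theorem pow_ne_zero (h : IsNodalPair x y) (n : ℕ) : x ^ n ≠ 0 := by
  induction n with
  | zero => simp
  | succ n ih =>
    obtain _ | n := n
    · simpa using h.left_ne_zero
    · intro h0
      refine ih (eq_zero_of_mem_of_mem h.inf_eq ?_ (h.mem_of_mul_left_eq_zero _ (by rw [← pow_succ, h0])))
      rw [pow_succ]
      exact Ideal.mul_mem_left _ _ (Ideal.mem_span_singleton_self x)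

end IsNodalPair

/-- If every prime containing the non-nilpotent element `z` is maximal, then the dimension is
one. -/
theorem ringKrullDim_eq_one_of_not_isNilpotent [IsNoetherianRing R] {z : R}
    (hz : z ∈ maximalIdeal R)
    (hp : ∀ p : Ideal R, p.IsPrime → z ∈ p → p = maximalIdeal R) (hnil : ¬ IsNilpotent z) :
    ringKrullDim R = 1 := by
  rw [← IsLocalRing.maximalIdeal_height_eq_ringKrullDim]
  have h₁ : (maximalIdeal R).height ≤ 1 := by
    have hzm : Ideal.span {z} ≤ maximalIdeal R := (Ideal.span_singleton_le_iff_mem _).2 hz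
    obtain ⟨p, hpmin, -⟩ := Ideal.exists_minimalPrimes_le hzm
    rw [← hp p hpmin.1.1 (hpmin.1.2 (Ideal.mem_span_singleton_self z))]
    exact Ideal.height_le_one_of_isPrincipal_of_mem_minimalPrimes (Ideal.span {z}) p hpmin
  have h₂ : (maximalIdeal R).height ≠ 0 := by
    intro h0
    rw [Ideal.height_eq_zero_iff] at h0
    refine hnil (mem_nilradical.1 ?_)
    rw [nilradical_eq_sInf, Submodule.mem_sInf]
    intro p hpp
    have hpm : p ≤ maximalIdeal R := le_maximalIdeal hpp.ne_top
    exact h0.2 ⟨hpp, bot_le⟩ hpm hz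
  rw [le_antisymm h₁ (Order.one_le_iff_pos.2 (pos_iff_ne_zero.2 h₂))]
  rfl

namespace IsNodalPair

theorem ringKrullDim_eq_one [IsNoetherianRing R] (h : IsNodalPair x y) : ringKrullDim R = 1 := by
  have hxy := h.mul_eq_zero
  refine ringKrullDim_eq_one_of_not_isNilpotent (z := x + y)
    (add_mem h.left_mem h.right_mem) (fun p hp hz ↦ ?_) ?_
  · refine le_antisymm (le_maximalIdeal hp.ne_top) ?_
    have hx : x ∈ p := by
      refine hp.mem_of_pow_mem 2 ?_
      convert p.mul_mem_left x hz using 1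
      linear_combination -hxy
    have hy : y ∈ p := by simpa using p.sub_mem hz hx
    rw [← h.sup_eq, sup_le_iff, Ideal.span_singleton_le_iff_mem, Ideal.span_singleton_le_iff_mem]
    exact ⟨hx, hy⟩
  · rintro ⟨n, hn⟩
    have key : ∀ n : ℕ, x * (x + y) ^ n = x ^ (n + 1) := by
      intro n
      induction n with
      | zero => simp
      | succ n ih => rw [pow_succ, ← mul_assoc, ih]; linear_combination x ^ n * hxy
    exact h.pow_ne_zero (n + 1) (by rw [← key, hn, mul_zero])

end IsNodalPair

end NodalPair

section InjectiveDimension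

open Abelian

variable {R : Type u} [CommRing R]

theorem hasInjectiveDimensionLT_two_of_forall_prime [IsNoetherianRing R]
    (N : Type u) [AddCommGroup N] [Module R N]
    (h : ∀ p : Ideal R, p.IsPrime →
      Subsingleton (Ext (ModuleCat.of R (R ⧸ p)) (ModuleCat.of R N) 2)) :
    HasInjectiveDimensionLT (ModuleCat.of R N) 2 := by
  have hfin : ∀ (M : Type u) [AddCommGroup M] [Module R M], Module.Finite R M →
      Subsingleton (Ext (ModuleCat.of R M) (ModuleCat.of R N) 2) := by
    intro M _ _ hM
    induction hM using IsNoetherianRing.induction_on_isQuotientEquivQuotientPrime R with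
    | subsingleton M =>
      exact subsingleton_ext_of_retract (B := R ⧸ (⊤ : Ideal R)) 0 0 (Subsingleton.elim _ _) 2
        (subsingleton_of_forall_eq 0 fun x ↦ by
          have : Limits.IsZero (ModuleCat.of R (R ⧸ (⊤ : Ideal R))) :=
            ModuleCat.isZero_of_subsingleton _
          rw [← Ext.mk₀_id_comp x, this.eq_of_src (𝟙 _) 0, Ext.mk₀_zero, Ext.zero_comp])
    | quotient M p e =>
      exact subsingleton_ext_of_retract e.toLinearMap e.symm.toLinearMap
        (by ext; simp) 2 (h p.1 p.2)
    | exact A B C f g hf hg hfg hA hC => exact subsingleton_ext_middle hf hg hfg 2 hA hC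
  let E := Injective.under (ModuleCat.of R N)
  let i : ModuleCat.of R N ⟶ E := Injective.ι _
  let S : ShortComplex (ModuleCat R) := ShortComplex.mk i (Limits.cokernel.π i) (by simp)
  have hS : S.ShortExact :=
    { exact := ShortComplex.exact_cokernel i
      mono_f := inferInstanceAs (Mono i)
      epi_g := inferInstanceAs (Epi (Limits.cokernel.π i)) }
  have hSinj : Injective S.X₂ := inferInstanceAs (Injective E)
  refine (hS.hasInjectiveDimensionLT_X₃_iff 0 hSinj).1 ?_
  have hbaer : Module.Baer R S.X₃ := by
    intro I φ
    have hext : Subsingleton (Ext (ModuleCat.of R (R ⧸ I)) S.X₃ 1) := by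
      refine subsingleton_of_forall_eq 0 fun x ↦ ?_
      have := hfin (R ⧸ I) inferInstance
      obtain ⟨y, rfl⟩ := Ext.covariant_sequence_exact₃ _ hS x (n₁ := 2) rfl
        (this.elim _ _)
      rw [Ext.eq_zero_of_injective (I := S.X₂) y, Ext.zero_comp]
    obtain ⟨φ', hφ'⟩ := exists_extension_of_subsingleton_ext_one (N := S.X₃) (f := I.subtype)
      (g := I.mkQ) (Submodule.subtype_injective I) I.mkQ_surjective
      (LinearMap.exact_subtype_mkQ I) hext φ
    exact ⟨φ', fun z hz ↦ LinearMap.congr_fun hφ' ⟨z, hz⟩⟩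
  have hinj := hbaer.injective
  have : Injective S.X₃ := Module.injective_object_of_injective_module R S.X₃
  infer_instance

end InjectiveDimension

namespace IsNodalPair

variable {R : Type u} [CommRing R] [IsLocalRing R] {x y : R}

theorem exists_extension (h : IsNodalPair x y) (φ : Ideal.span {y} →ₗ[R] R) :
    ∃ φ' : R →ₗ[R] R, φ' ∘ₗ (Ideal.span {y}).subtype = φ := by
  let y' : Ideal.span {y} := ⟨y, Ideal.mem_span_singleton_self y⟩
  have hy : φ y' * x = 0 := by
    rw [mul_comm, ← smul_eq_mul, ← map_smul]
    convert map_zero φ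
    exact Subtype.ext h.mul_eq_zero
  obtain ⟨c, hc⟩ := Ideal.mem_span_singleton'.1 (h.mem_of_mul_left_eq_zero _ hy)
  refine ⟨LinearMap.lsmul R R c, LinearMap.ext fun z ↦ ?_⟩
  obtain ⟨z, hz⟩ := z
  obtain ⟨r, rfl⟩ := Ideal.mem_span_singleton'.1 hz
  have : (⟨r * y, hz⟩ : Ideal.span {y}) = r • y' := rfl
  rw [this, map_smul, map_smul, ← hc]
  rfl

theorem subsingleton_ext_two_quotient (h : IsNodalPair x y) :
    Subsingleton (Abelian.Ext (ModuleCat.of R (R ⧸ Ideal.span {y})) (ModuleCat.of R R) 2) := by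
  refine subsingleton_ext_right_of_left (f := (Ideal.span {y}).subtype)
    (Submodule.subtype_injective _) (Ideal.span {y}).mkQ_surjective
    (LinearMap.exact_subtype_mkQ _) 0 ?_
  refine subsingleton_ext_one_of_extension (B := R) (f := (Ideal.span {x}).subtype)
    (g := LinearMap.toSpanSingleton R (Ideal.span {y}) ⟨y, Ideal.mem_span_singleton_self y⟩)
    (Submodule.subtype_injective _) ?_ ?_ h.symm.exists_extension
  · rintro ⟨z, hz⟩
    obtain ⟨r, rfl⟩ := Ideal.mem_span_singleton'.1 hz
    exact ⟨r, rfl⟩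
  · intro r
    have : LinearMap.toSpanSingleton R (Ideal.span {y}) ⟨y, Ideal.mem_span_singleton_self y⟩ r = 0
        ↔ r * y = 0 := Subtype.ext_iff
    rw [this]
    constructor
    · exact fun hr ↦ ⟨⟨r, h.mem_of_mul_right_eq_zero r hr⟩, rfl⟩
    · rintro ⟨⟨r, hr⟩, rfl⟩
      exact mul_eq_zero_of_inf_eq_bot h.inf_eq hr (Ideal.mem_span_singleton_self y)

theorem subsingleton_ext_two_residue (h : IsNodalPair x y) :
    Subsingleton (Abelian.Ext (ModuleCat.of R (R ⧸ maximalIdeal R)) (ModuleCat.of R R) 2) := by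
  refine subsingleton_ext_right_of_left (f := (maximalIdeal R).subtype)
    (Submodule.subtype_injective _) (maximalIdeal R).mkQ_surjective
    (LinearMap.exact_subtype_mkQ _) 0 ?_
  refine subsingleton_ext_one_of_extension (B := R × R)
    (f := (Ideal.span {y}).subtype.prodMap (Ideal.span {x}).subtype)
    (g := (LinearMap.toSpanSingleton R (maximalIdeal R) ⟨x, h.left_mem⟩).coprod
      (LinearMap.toSpanSingleton R (maximalIdeal R) ⟨y, h.right_mem⟩)) ?_ ?_ ?_ ?_
  · exact (Submodule.subtype_injective _).prodMap (Submodule.subtype_injective _)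
  · rintro ⟨z, hz⟩
    obtain ⟨a, b, rfl⟩ := h.mem_maximalIdeal_iff.1 hz
    exact ⟨(a, b), rfl⟩
  · rintro ⟨a, b⟩
    have : ((LinearMap.toSpanSingleton R (maximalIdeal R) ⟨x, h.left_mem⟩).coprod
      (LinearMap.toSpanSingleton R (maximalIdeal R) ⟨y, h.right_mem⟩)) (a, b) = 0
        ↔ a * x + b * y = 0 := Subtype.ext_iff
    rw [this]
    constructor
    · intro hab
      have ha : a * x = 0 := by
        refine eq_zero_of_mem_of_mem h.inf_eq (Ideal.mem_span_singleton'.2 ⟨a, rfl⟩) ?_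
        rw [eq_neg_of_add_eq_zero_left hab]
        exact neg_mem (Ideal.mem_span_singleton'.2 ⟨b, rfl⟩)
      have hb : b * y = 0 := by rwa [ha, zero_add] at hab
      exact ⟨(⟨a, h.mem_of_mul_left_eq_zero a ha⟩, ⟨b, h.mem_of_mul_right_eq_zero b hb⟩), rfl⟩
    · rintro ⟨⟨⟨a, ha⟩, ⟨b, hb⟩⟩, hab⟩
      obtain ⟨rfl, rfl⟩ := Prod.ext_iff.1 hab
      have h₁ := mul_eq_zero_of_inf_eq_bot h.symm.inf_eq ha (Ideal.mem_span_singleton_self x)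
      have h₂ := mul_eq_zero_of_inf_eq_bot h.inf_eq hb (Ideal.mem_span_singleton_self y)
      simp [h₁, h₂]
  · intro φ
    obtain ⟨φ₁, hφ₁⟩ := h.exists_extension (φ ∘ₗ LinearMap.inl R _ _)
    obtain ⟨φ₂, hφ₂⟩ := h.symm.exists_extension (φ ∘ₗ LinearMap.inr R _ _)
    refine ⟨φ₁.coprod φ₂, ?_⟩
    ext z
    · simpa using LinearMap.congr_fun hφ₁ z
    · simpa using LinearMap.congr_fun hφ₂ z

theorem eq_span_singleton_of_mem (h : IsNodalPair x y) {p : Ideal R} [IsNoetherianRing R]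
    (hp : p.IsPrime) (hy : y ∈ p) : p = Ideal.span {y} ∨ p = maximalIdeal R := by
  have hpm : p ≤ maximalIdeal R := le_maximalIdeal hp.ne_top
  have hyp : Ideal.span {y} ≤ p := (Ideal.span_singleton_le_iff_mem _).2 hy
  by_cases hx : x ∈ p
  · refine .inr (le_antisymm hpm ?_)
    rw [← h.sup_eq]
    exact sup_le ((Ideal.span_singleton_le_iff_mem _).2 hx) hyp
  · refine .inl (le_antisymm ?_ hyp)
    refine Submodule.le_of_le_smul_of_le_jacobson_bot (IsNoetherian.noetherian p)
      (maximalIdeal_le_jacobson _) fun z hz ↦ ?_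
    obtain ⟨a, b, rfl⟩ := h.mem_maximalIdeal_iff.1 (hpm hz)
    have hax : a * x ∈ p := by simpa using p.sub_mem hz (p.mul_mem_left b hy)
    have ha : a ∈ p := (hp.mem_or_mem hax).resolve_right hx
    rw [add_comm]
    refine Submodule.add_mem_sup (Ideal.mem_span_singleton'.2 ⟨b, rfl⟩) ?_
    rw [mul_comm]
    exact Submodule.smul_mem_smul h.left_mem ha

theorem isGorensteinLocal [IsNoetherianRing R] (h : IsNodalPair x y) : IsGorensteinLocal R := by
  have hdim : HasInjectiveDimensionLT (ModuleCat.of R R) 2 := by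
    refine hasInjectiveDimensionLT_two_of_forall_prime R fun p hp ↦ ?_
    have hxy : x * y ∈ p := h.mul_eq_zero ▸ p.zero_mem
    rcases hp.mem_or_mem hxy with hx | hy
    · rcases h.symm.eq_span_singleton_of_mem hp hx with rfl | rfl
      · exact h.symm.subsingleton_ext_two_quotient
      · exact h.subsingleton_ext_two_residue
    · rcases h.eq_span_singleton_of_mem hp hy with rfl | rfl
      · exact h.subsingleton_ext_two_quotient
      · exact h.subsingleton_ext_two_residue
  refine ⟨1, fun M _ _ i hi ↦ ?_⟩
  obtain ⟨i, rfl⟩ := Nat.exists_eq_add_of_lt hi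
  rw [subsingleton_extGrp_succ_iff]
  exact subsingleton_of_forall_eq 0 fun e ↦
    Abelian.Ext.eq_zero_of_hasInjectiveDimensionLT e 2 (by lia)

end IsNodalPair

section MinimalGenerators

variable {R : Type u} [CommRing R] {I : Ideal R}

theorem exists_card_eq_minGens (hI : I.FG) :
    ∃ s : Finset R, s.card = minGens I ∧ Ideal.span (s : Set R) = I := by
  obtain ⟨s, hs⟩ := hI
  exact Nat.sInf_mem (s := {n | ∃ s : Finset R, s.card = n ∧ Ideal.span (s : Set R) = I})
    ⟨_, s, rfl, hs⟩

theorem minGens_le_card {s : Finset R} (hs : Ideal.span (s : Set R) = I) :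
    minGens I ≤ s.card :=
  Nat.sInf_le ⟨s, rfl, hs⟩

theorem exists_eq_span_singleton_of_minGens_le_one (hI : I.FG) (h : minGens I ≤ 1) :
    ∃ u, I = Ideal.span {u} := by
  obtain ⟨s, hs, rfl⟩ := exists_card_eq_minGens hI
  rcases Finset.card_le_one_iff_subset_singleton.1 (hs.trans_le h) with ⟨u, hu⟩
  rcases Finset.subset_singleton_iff.1 hu with rfl | rfl
  · exact ⟨0, by simp⟩
  · exact ⟨u, by simp⟩

theorem exists_eq_span_pair_of_minGens_le_two (hI : I.FG) (h : minGens I ≤ 2) :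
    ∃ u v, I = Ideal.span {u, v} := by
  obtain h | h := Nat.lt_or_eq_of_le h
  · obtain ⟨u, hu⟩ := exists_eq_span_singleton_of_minGens_le_one hI (Nat.le_of_lt_succ h)
    exact ⟨u, u, by simpa using hu⟩
  · classical
    obtain ⟨s, hs, rfl⟩ := exists_card_eq_minGens hI
    obtain ⟨u, v, -, rfl⟩ := Finset.card_eq_two.1 (hs.trans h)
    exact ⟨u, v, by simp⟩

theorem minGens_span_singleton {u : R} (hu : u ≠ 0) : minGens (Ideal.span {u}) = 1 := by
  refine le_antisymm (minGens_le_card (s := {u}) (by simp)) (Nat.one_le_iff_ne_zero.2 fun h ↦ hu ?_)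
  obtain ⟨s, hs, hsu⟩ := exists_card_eq_minGens (Submodule.fg_span_singleton (R := R) u)
  rw [Finset.card_eq_zero.1 (hs.trans h), Finset.coe_empty, Ideal.span_empty, eq_comm] at hsu
  exact Ideal.span_singleton_eq_bot.1 hsu

end MinimalGenerators

section Depth

variable {R : Type u} [CommRing R] [IsLocalRing R] {I J : Ideal R}

theorem subsingleton_extGrp_zero_residueField_iff :
    Subsingleton (extGrp R 0 (ResidueField R) R) ↔
      ∀ s : R, (∀ z ∈ maximalIdeal R, z * s = 0) → s = 0 := by
  rw [subsingleton_extGrp_zero_iff]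
  constructor
  · intro h s hs
    let f : (R ⧸ maximalIdeal R) →ₗ[R] R :=
      (maximalIdeal R).liftQ (LinearMap.toSpanSingleton R R s) hs
    have hf : f = 0 := h f
    have : f (Submodule.Quotient.mk 1) = s := one_smul R s
    rw [← this, hf, LinearMap.zero_apply]
  · intro h f
    have hs : f (residue R 1) = 0 := by
      refine h _ fun z hz ↦ ?_
      rw [← smul_eq_mul, ← map_smul]
      have : z • residue R 1 = residue R (z * 1) := rfl
      rw [this, mul_one, (residue_eq_zero_iff z).2 hz, map_zero]
    ext a
    obtain ⟨a, rfl⟩ := residue_surjective a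
    have : residue R a = a • residue R 1 := by
      change residue R a = residue R (a * 1)
      rw [mul_one]
    rw [this, map_smul, hs, smul_zero, LinearMap.zero_apply]

theorem not_subsingleton_extGrp_one_residueField (h : HasDecomposableMaxIdeal R) :
    ¬ Subsingleton (extGrp R 1 (ResidueField R) R) := by
  obtain ⟨I, J, hI, hJ, hIJ, hsup⟩ := h
  rw [subsingleton_extGrp_succ_iff]
  intro h
  obtain ⟨p, hp⟩ := exists_projection_of_inf_eq_bot hIJ hsup
  obtain ⟨f, hf⟩ := exists_extension_of_subsingleton_ext_one (C := R ⧸ maximalIdeal R)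
    (f := (maximalIdeal R).subtype)
    (Submodule.subtype_injective _) (maximalIdeal R).mkQ_surjective
    (LinearMap.exact_subtype_mkQ _) h (J.subtype ∘ₗ p)
  have hfp : ∀ z (hz : z ∈ maximalIdeal R), z * f 1 = p ⟨z, hz⟩ := by
    intro z hz
    rw [← smul_eq_mul, ← map_smul, smul_eq_mul, mul_one]
    exact LinearMap.congr_fun hf ⟨z, hz⟩
  rcases isUnit_or_isUnit_one_sub_self (f 1) with hu | hu
  · refine hI (eq_bot_iff.2 fun z hz ↦ ?_)
    have hzm : z ∈ maximalIdeal R := hsup ▸ (le_sup_left : I ≤ I ⊔ J) hz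
    refine hu.mul_left_eq_zero.1 ?_
    refine eq_zero_of_mem_of_mem hIJ (I.mul_mem_right _ hz) ?_
    rw [hfp z hzm]
    exact Subtype.prop _
  · refine hJ (eq_bot_iff.2 fun z hz ↦ ?_)
    have hzm : z ∈ maximalIdeal R := hsup ▸ (le_sup_right : J ≤ I ⊔ J) hz
    refine hu.mul_left_eq_zero.1 ?_
    rw [mul_sub, mul_one]
    refine eq_zero_of_mem_of_mem hIJ ?_ (J.sub_mem hz (J.mul_mem_right _ hz))
    rw [hfp z hzm]
    exact hp ⟨z, hzm⟩

theorem moduleDepth_le_one (h : HasDecomposableMaxIdeal R) : moduleDepth R R ≤ 1 :=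
  sInf_le ⟨1, rfl, not_subsingleton_extGrp_one_residueField h⟩

theorem one_le_moduleDepth_iff :
    1 ≤ moduleDepth R R ↔ ∀ s : R, (∀ z ∈ maximalIdeal R, z * s = 0) → s = 0 := by
  rw [← subsingleton_extGrp_zero_residueField_iff]
  constructor
  · intro h
    by_contra h0
    have : moduleDepth R R ≤ 0 := sInf_le ⟨0, rfl, h0⟩
    exact absurd (h.trans this) (by simp)
  · intro h
    refine le_sInf ?_
    rintro _ ⟨i, rfl, hi⟩
    obtain _ | i := i
    · exact absurd h hi
    · exact_mod_cast Nat.succ_le_succ (Nat.zero_le i)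

theorem maximalIdeal_ne_span_singleton (h : HasDecomposableMaxIdeal R) (u : R) :
    maximalIdeal R ≠ Ideal.span {u} := by
  obtain ⟨I, J, hI, hJ, hIJ, hsup⟩ := h
  intro hu
  have hIm : I ≤ maximalIdeal R := hsup ▸ le_sup_left
  have hJm : J ≤ maximalIdeal R := hsup ▸ le_sup_right
  have hum : u ∈ I ⊔ J := hsup ▸ hu ▸ Ideal.mem_span_singleton_self u
  have huI : u ∉ I := fun huI ↦ hJ (by
    rw [← hIJ, eq_comm, inf_eq_right]
    exact hJm.trans (hu ▸ (Ideal.span_singleton_le_iff_mem _).2 huI))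
  have huJ : u ∉ J := fun huJ ↦ hI (by
    rw [← hIJ, eq_comm, inf_eq_left]
    exact hIm.trans (hu ▸ (Ideal.span_singleton_le_iff_mem _).2 huJ))
  obtain ⟨i, hi, j, hj, hij⟩ := Submodule.mem_sup.1 hum
  obtain ⟨c, hc⟩ := Ideal.mem_span_singleton'.1 (hu ▸ hIm hi)
  obtain ⟨d, hd⟩ := Ideal.mem_span_singleton'.1 (hu ▸ hJm hj)
  have hcm : c ∈ maximalIdeal R := by
    rw [mem_maximalIdeal, mem_nonunits_iff]
    exact fun hcu ↦ huI ((Ideal.unit_mul_mem_iff_mem I hcu).1 (hc ▸ hi))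
  have hdm : d ∈ maximalIdeal R := by
    rw [mem_maximalIdeal, mem_nonunits_iff]
    exact fun hdu ↦ huJ ((Ideal.unit_mul_mem_iff_mem J hdu).1 (hd ▸ hj))
  have hunit : IsUnit (1 - (c + d)) :=
    (isUnit_or_isUnit_one_sub_self (c + d)).resolve_left (add_mem hcm hdm)
  have hu0 : u = 0 := hunit.mul_right_eq_zero.1 (by linear_combination -hij - hc - hd)
  exact huI (hu0 ▸ I.zero_mem)

theorem exists_eq_span_singleton_of_span_pair [IsNoetherianRing R] (hJ : J ≠ ⊥)
    (hIJ : I ⊓ J = ⊥) (hsup : I ⊔ J = maximalIdeal R) {u v : R}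
    (huv : maximalIdeal R = Ideal.span {u, v}) : ∃ x, I = Ideal.span {x} := by
  have hum : u ∈ I ⊔ J := hsup ▸ huv ▸ Ideal.subset_span (by simp)
  have hvm : v ∈ I ⊔ J := hsup ▸ huv ▸ Ideal.subset_span (by simp)
  obtain ⟨u₁, hu₁, u₂, hu₂, rfl⟩ := Submodule.mem_sup.1 hum
  obtain ⟨v₁, hv₁, v₂, hv₂, rfl⟩ := Submodule.mem_sup.1 hvm
  have hspan : ∀ z ∈ I, ∃ a b, a * u₁ + b * v₁ = z := by
    intro z hz
    have hzm : z ∈ maximalIdeal R := hsup ▸ (le_sup_left : I ≤ I ⊔ J) hz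
    obtain ⟨a, b, hab⟩ := Ideal.mem_span_pair.1 (huv ▸ hzm)
    refine ⟨a, b, ?_⟩
    rw [← sub_eq_zero]
    refine eq_zero_of_mem_of_mem hIJ
      (I.sub_mem (I.add_mem (I.mul_mem_left a hu₁) (I.mul_mem_left b hv₁)) hz) ?_
    have : a * u₁ + b * v₁ - z = -(a * u₂ + b * v₂) := by linear_combination hab
    rw [this]
    exact neg_mem (J.add_mem (J.mul_mem_left a hu₂) (J.mul_mem_left b hv₂))
  by_cases hunit : ∃ a b, a * u₁ + b * v₁ = 0 ∧ (IsUnit a ∨ IsUnit b)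
  · obtain ⟨a, b, hab, ha | hb⟩ := hunit
    · refine ⟨v₁, le_antisymm (fun z hz ↦ ?_) ((Ideal.span_singleton_le_iff_mem _).2 hv₁)⟩
      obtain ⟨c, d, rfl⟩ := hspan z hz
      have : u₁ ∈ Ideal.span {v₁} := by
        rw [← Ideal.unit_mul_mem_iff_mem _ ha, eq_neg_of_add_eq_zero_left hab]
        exact neg_mem (Ideal.mem_span_singleton'.2 ⟨b, rfl⟩)
      exact add_mem (Ideal.mul_mem_left _ _ this) (Ideal.mem_span_singleton'.2 ⟨d, rfl⟩)
    · refine ⟨u₁, le_antisymm (fun z hz ↦ ?_) ((Ideal.span_singleton_le_iff_mem _).2 hu₁)⟩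
      obtain ⟨c, d, rfl⟩ := hspan z hz
      have : v₁ ∈ Ideal.span {u₁} := by
        rw [← Ideal.unit_mul_mem_iff_mem _ hb, eq_neg_of_add_eq_zero_right hab]
        exact neg_mem (Ideal.mem_span_singleton'.2 ⟨a, rfl⟩)
      exact add_mem (Ideal.mem_span_singleton'.2 ⟨c, rfl⟩) (Ideal.mul_mem_left _ _ this)
  · push Not at hunit
    refine absurd (Submodule.eq_bot_of_le_smul_of_le_jacobson_bot (maximalIdeal R) J
      (IsNoetherian.noetherian J) (fun z hz ↦ ?_) (maximalIdeal_le_jacobson _)) hJ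
    have hzm : z ∈ maximalIdeal R := hsup ▸ (le_sup_right : J ≤ I ⊔ J) hz
    obtain ⟨a, b, hab⟩ := Ideal.mem_span_pair.1 (huv ▸ hzm)
    have h0 : a * u₁ + b * v₁ = 0 := by
      refine eq_zero_of_mem_of_mem hIJ
        (I.add_mem (I.mul_mem_left a hu₁) (I.mul_mem_left b hv₁)) ?_
      have : a * u₁ + b * v₁ = z - (a * u₂ + b * v₂) := by linear_combination hab
      rw [this]
      exact J.sub_mem hz (J.add_mem (J.mul_mem_left a hu₂) (J.mul_mem_left b hv₂))
    obtain ⟨ha, hb⟩ := hunit a b h0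
    have : z = a * u₂ + b * v₂ := by linear_combination h0 - hab
    rw [this]
    exact add_mem (Submodule.smul_mem_smul ha hu₂) (Submodule.smul_mem_smul hb hv₂)

theorem exists_isNodalPair_of_isHypersurfaceLocal [IsNoetherianRing R]
    (hdec : HasDecomposableMaxIdeal R) (hR : IsHypersurfaceLocal R) :
    ∃ x y : R, IsNodalPair x y := by
  obtain ⟨d, hd, hgens⟩ := hR
  have hfg : (maximalIdeal R).FG := IsNoetherian.noetherian _
  have hd₁ : d ≤ 1 := by
    have := moduleDepth_le_one hdec
    rw [hd] at this
    exact_mod_cast this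
  have hd₀ : 1 ≤ d := by
    by_contra! h
    obtain ⟨u, hu⟩ := exists_eq_span_singleton_of_minGens_le_one hfg (by lia)
    exact maximalIdeal_ne_span_singleton hdec u hu
  have hsoc := one_le_moduleDepth_iff.1 (by rw [hd]; exact_mod_cast hd₀ : 1 ≤ moduleDepth R R)
  obtain ⟨u, v, huv⟩ := exists_eq_span_pair_of_minGens_le_two hfg (by lia)
  obtain ⟨I, J, hI, hJ, hIJ, hsup⟩ := hdec
  obtain ⟨x, hx⟩ := exists_eq_span_singleton_of_span_pair hJ hIJ hsup huv
  obtain ⟨y, hy⟩ := exists_eq_span_singleton_of_span_pair hI (by rwa [inf_comm])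
    (by rwa [sup_comm]) huv
  subst hx hy
  rw [Ne, Ideal.span_singleton_eq_bot] at hI hJ
  exact ⟨x, y, isNodalPair_of_socle_eq_bot hI hJ hsup hIJ hsoc⟩

theorem IsNodalPair.isHypersurfaceLocal {x y : R} (h : IsNodalPair x y) :
    IsHypersurfaceLocal R := by
  classical
  refine ⟨1, le_antisymm (moduleDepth_le_one h.hasDecomposableMaxIdeal)
    (one_le_moduleDepth_iff.2 fun _ ↦ h.eq_zero_of_forall_mul_eq_zero), ?_⟩
  refine (minGens_le_card (s := {x, y}) ?_).trans Finset.card_le_two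
  rw [← h.sup_eq, ← Ideal.span_union, Set.singleton_union, Finset.coe_pair]

end Depth

section OneDimensionalRegular

variable {R : Type u} [CommRing R] [IsLocalRing R] {s : R}

theorem isRegularLocal_of_maximalIdeal_eq_span [IsNoetherianRing R]
    (hs : maximalIdeal R = Ideal.span {s}) (hnil : ¬ IsNilpotent s) :
    IsRegularLocal R ∧ ringKrullDim R = (1 : WithBot ℕ∞) := by
  have hdim : ringKrullDim R = 1 := by
    refine ringKrullDim_eq_one_of_not_isNilpotent (hs ▸ Ideal.mem_span_singleton_self s)
      (fun p hp hsp ↦ le_antisymm (le_maximalIdeal hp.ne_top) ?_) hnil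
    rw [hs]
    exact (Ideal.span_singleton_le_iff_mem _).2 hsp
  refine ⟨⟨1, hdim, ?_⟩, hdim⟩
  rw [hs]
  exact minGens_span_singleton fun h0 ↦ hnil (h0 ▸ IsNilpotent.zero)

theorem not_isNilpotent_of_ringKrullDim_eq_one (hs : maximalIdeal R = Ideal.span {s})
    (hdim : ringKrullDim R = 1) : ¬ IsNilpotent s := by
  intro hnil
  have h0 : (maximalIdeal R).height = 0 := by
    rw [Ideal.height_eq_zero_iff]
    refine ⟨⟨inferInstance, bot_le⟩, fun p hp _ ↦ ?_⟩
    rw [hs, Ideal.span_singleton_le_iff_mem]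
    have : s ∈ nilradical R := hnil
    rw [nilradical_eq_sInf, Submodule.mem_sInf] at this
    exact this p hp.1
  rw [← IsLocalRing.maximalIdeal_height_eq_ringKrullDim, h0] at hdim
  exact absurd hdim (by simp)

theorem eq_zero_of_mul_generator_eq_zero [IsNoetherianRing R]
    (hs : maximalIdeal R = Ideal.span {s}) (hnil : ¬ IsNilpotent s) {c : R} (hc : c * s = 0) :
    c = 0 := by
  have hpow : ∀ n, ∃ a, a * s ^ n = c := by
    intro n
    induction n with
    | zero => exact ⟨c, by simp⟩
    | succ n ih =>
      obtain ⟨a, rfl⟩ := ih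
      have ha : a ∈ maximalIdeal R := by
        rw [mem_maximalIdeal, mem_nonunits_iff]
        intro hu
        rw [mul_assoc, ← pow_succ] at hc
        exact hnil ⟨n + 1, hu.mul_right_eq_zero.1 hc⟩
      obtain ⟨b, rfl⟩ := Ideal.mem_span_singleton'.1 (hs ▸ ha)
      exact ⟨b, by ring⟩
  have : c ∈ (⨅ n, maximalIdeal R ^ n : Ideal R) := by
    rw [Submodule.mem_iInf]
    intro n
    obtain ⟨a, rfl⟩ := hpow n
    exact Ideal.mul_mem_left _ _
      (Ideal.pow_mem_pow (hs ▸ Ideal.mem_span_singleton_self s) n)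
  rwa [Ideal.iInf_pow_eq_bot_of_isLocalRing _ (Ideal.IsPrime.ne_top inferInstance)] at this

theorem IsRegularLocal.exists_generator [IsNoetherianRing R] (h : IsRegularLocal R)
    (hdim : ringKrullDim R = 1) :
    ∃ s, maximalIdeal R = Ideal.span {s} ∧ ∀ c, c * s = 0 → c = 0 := by
  obtain ⟨d, hd, hgens⟩ := h
  have hd₁ : d = 1 := by
    rw [hdim] at hd
    exact_mod_cast hd.symm
  obtain ⟨s, hs⟩ := exists_eq_span_singleton_of_minGens_le_one (IsNoetherian.noetherian _)
    (hgens.trans hd₁).le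
  exact ⟨s, hs, fun _ ↦ eq_zero_of_mul_generator_eq_zero hs
    (not_isNilpotent_of_ringKrullDim_eq_one hs hdim)⟩

end OneDimensionalRegular

namespace IsNodalPair

variable {R : Type u} [CommRing R] [IsLocalRing R] {x y : R}

theorem isLocalRing_quotient (h : IsNodalPair x y) : IsLocalRing (R ⧸ Ideal.span {y}) := by
  have : Nontrivial (R ⧸ Ideal.span {y}) := by
    rw [Ideal.Quotient.nontrivial_iff, Ne, Ideal.span_singleton_eq_top]
    exact h.right_mem
  exact .of_surjective' (Ideal.Quotient.mk _) Ideal.Quotient.mk_surjective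

theorem isRegularLocal_quotient [IsNoetherianRing R] (h : IsNodalPair x y)
    [IsLocalRing (R ⧸ Ideal.span {y})] :
    IsRegularLocal (R ⧸ Ideal.span {y}) ∧
      ringKrullDim (R ⧸ Ideal.span {y}) = (1 : WithBot ℕ∞) := by
  refine isRegularLocal_of_maximalIdeal_eq_span (s := Ideal.Quotient.mk _ x) ?_ ?_
  · rw [← map_maximalIdeal_of_surjective (Ideal.Quotient.mk (Ideal.span {y}))
      Ideal.Quotient.mk_surjective, ← h.sup_eq, Ideal.map_sup, Ideal.map_quotient_self,
      sup_bot_eq, Ideal.map_span, Set.image_singleton]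
  · rintro ⟨n, hn⟩
    rw [← map_pow, Ideal.Quotient.eq_zero_iff_mem] at hn
    refine h.pow_ne_zero (n + 1) (eq_zero_of_mem_of_mem h.inf_eq ?_ ?_)
    · rw [pow_succ]
      exact Ideal.mul_mem_left _ _ (Ideal.mem_span_singleton_self x)
    · rw [pow_succ]
      exact Ideal.mul_mem_right _ _ hn

/-- The residue map of `R`, factored through `R ⧸ (y)`. -/
def quotientResidue (h : IsNodalPair x y) : R ⧸ Ideal.span {y} →+* ResidueField R :=
  Ideal.Quotient.factor ((Ideal.span_singleton_le_iff_mem _).2 h.right_mem)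

theorem isResidueSurjection_quotientResidue (h : IsNodalPair x y)
    [IsLocalRing (R ⧸ Ideal.span {y})] : IsResidueSurjection h.quotientResidue := by
  have hsurj : Function.Surjective h.quotientResidue := by
    intro a
    obtain ⟨a, rfl⟩ := residue_surjective a
    exact ⟨Ideal.Quotient.mk _ a, rfl⟩
  exact ⟨hsurj, eq_maximalIdeal (RingHom.ker_isMaximal_of_surjective _ hsurj)⟩

theorem nonempty_ringEquiv_fiberProduct (h : IsNodalPair x y) :
    Nonempty (R ≃+* fiberProduct h.quotientResidue h.symm.quotientResidue) := by
  let f : R →+* fiberProduct h.quotientResidue h.symm.quotientResidue :=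
    ((Ideal.Quotient.mk (Ideal.span {y})).prod (Ideal.Quotient.mk (Ideal.span {x}))).codRestrict
      _ fun _ ↦ rfl
  refine ⟨RingEquiv.ofBijective f ⟨?_, ?_⟩⟩
  · rw [injective_iff_map_eq_zero]
    intro r hr
    obtain ⟨h₁, h₂⟩ := Prod.ext_iff.1 (congrArg Subtype.val hr)
    exact eq_zero_of_mem_of_mem h.symm.inf_eq (Ideal.Quotient.eq_zero_iff_mem.1 h₁)
      (Ideal.Quotient.eq_zero_iff_mem.1 h₂)
  · rintro ⟨⟨a, b⟩, hab⟩
    obtain ⟨a, rfl⟩ := Ideal.Quotient.mk_surjective a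
    obtain ⟨b, rfl⟩ := Ideal.Quotient.mk_surjective b
    have hab' : residue R a = residue R b := hab
    rw [← sub_eq_zero, ← map_sub, residue_eq_zero_iff, h.mem_maximalIdeal_iff] at hab'
    obtain ⟨c, d, hcd⟩ := hab'
    refine ⟨a - d * y, Subtype.ext (Prod.ext ?_ ?_)⟩
    · refine Ideal.Quotient.eq.2 (Ideal.mem_span_singleton'.2 ⟨-d, by ring⟩)
    · refine Ideal.Quotient.eq.2 (Ideal.mem_span_singleton'.2 ⟨c, ?_⟩)
      linear_combination hcd

end IsNodalPair

section FiberProduct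

variable {R S T k : Type u} [CommRing R] [IsLocalRing R] [CommRing S] [IsLocalRing S]
  [CommRing T] [IsLocalRing T] [Field k] {πS : S →+* k} {πT : T →+* k}

theorem IsResidueSurjection.mem_maximalIdeal_iff (h : IsResidueSurjection πS) {a : S} :
    a ∈ maximalIdeal S ↔ πS a = 0 := by
  rw [← h.2, RingHom.mem_ker]

theorem exists_isNodalPair_of_ringEquiv_fiberProduct (hS : IsResidueSurjection πS)
    (hT : IsResidueSurjection πT) (e : R ≃+* fiberProduct πS πT) {s : S} {t : T}
    (hs : maximalIdeal S = Ideal.span {s}) (hs₀ : ∀ c, c * s = 0 → c = 0)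
    (ht : maximalIdeal T = Ideal.span {t}) (ht₀ : ∀ c, c * t = 0 → c = 0) :
    ∃ x y : R, IsNodalPair x y := by
  let p : R →+* S := (RingHom.fst S T).comp ((fiberProduct πS πT).subtype.comp e.toRingHom)
  let q : R →+* T := (RingHom.snd S T).comp ((fiberProduct πS πT).subtype.comp e.toRingHom)
  have hinj : ∀ r, p r = 0 → q r = 0 → r = 0 := fun r h₁ h₂ ↦
    e.injective (Subtype.ext ((Prod.ext h₁ h₂).trans
      (congrArg Subtype.val (map_zero e)).symm))
  have hlift : ∀ a b, πS a = πT b → ∃ r, p r = a ∧ q r = b := by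
    intro a b hab
    obtain ⟨r, hr⟩ := e.surjective ⟨(a, b), hab⟩
    exact ⟨r, congrArg (fun z ↦ z.1.1) hr, congrArg (fun z ↦ z.1.2) hr⟩
  have hp : Function.Surjective p := by
    intro a
    obtain ⟨b, hb⟩ := hT.1 (πS a)
    obtain ⟨r, hr, -⟩ := hlift a b hb.symm
    exact ⟨r, hr⟩
  have hq : Function.Surjective q := by
    intro b
    obtain ⟨a, ha⟩ := hS.1 (πT b)
    obtain ⟨r, -, hr⟩ := hlift a b ha
    exact ⟨r, hr⟩
  have hpm : ∀ r, p r ∈ maximalIdeal S ↔ r ∈ maximalIdeal R := by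
    have := IsLocalHom.of_surjective p hp
    simp [mem_nonunits_iff]
  have hqm : ∀ r, q r ∈ maximalIdeal T ↔ r ∈ maximalIdeal R := by
    have := IsLocalHom.of_surjective q hq
    simp [mem_nonunits_iff]
  have hsm : s ∈ maximalIdeal S := hs ▸ Ideal.mem_span_singleton_self s
  have htm : t ∈ maximalIdeal T := ht ▸ Ideal.mem_span_singleton_self t
  have hs' : s ≠ 0 := fun h ↦ one_ne_zero (hs₀ 1 (by rw [h, mul_zero]))
  have ht' : t ≠ 0 := fun h ↦ one_ne_zero (ht₀ 1 (by rw [h, mul_zero]))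
  obtain ⟨x, hxp, hxq⟩ := hlift s 0 (by rw [hS.mem_maximalIdeal_iff.1 hsm, map_zero])
  obtain ⟨y, hyp, hyq⟩ := hlift 0 t (by rw [hT.mem_maximalIdeal_iff.1 htm, map_zero])
  have hm : ∀ r ∈ maximalIdeal R, ∃ a b, a * x + b * y = r := by
    intro r hr
    obtain ⟨a, ha⟩ := Ideal.mem_span_singleton'.1 (hs ▸ (hpm r).2 hr)
    obtain ⟨b, hb⟩ := Ideal.mem_span_singleton'.1 (ht ▸ (hqm r).2 hr)
    obtain ⟨a, rfl⟩ := hp a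
    obtain ⟨b, rfl⟩ := hq b
    refine ⟨a, b, sub_eq_zero.1 (hinj _ ?_ ?_)⟩
    · simp [hxp, hyp, ha]
    · simp [hxq, hyq, hb]
  refine ⟨x, y, ⟨?_, ?_, ?_, ?_, fun c hc ↦ ?_, fun c hc ↦ ?_⟩⟩
  · rintro rfl
    exact hs' (by rw [← hxp, map_zero])
  · rintro rfl
    exact ht' (by rw [← hyq, map_zero])
  · refine le_antisymm (sup_le ?_ ?_) fun r hr ↦ ?_
    · rw [Ideal.span_singleton_le_iff_mem, ← hpm, hxp]
      exact hsm
    · rw [Ideal.span_singleton_le_iff_mem, ← hpm, hyp]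
      exact zero_mem _
    · obtain ⟨a, b, rfl⟩ := hm r hr
      exact Submodule.add_mem_sup (Ideal.mem_span_singleton'.2 ⟨a, rfl⟩)
        (Ideal.mem_span_singleton'.2 ⟨b, rfl⟩)
  · refine eq_bot_iff.2 fun z hz ↦ ?_
    obtain ⟨a, ha⟩ := Ideal.mem_span_singleton'.1 hz.1
    obtain ⟨b, hb⟩ := Ideal.mem_span_singleton'.1 hz.2
    exact hinj z (by rw [← hb, map_mul, hyp, mul_zero]) (by rw [← ha, map_mul, hxq, mul_zero])
  · have hpc : p c = 0 := hs₀ _ (by rw [← hxp, ← map_mul, hc, map_zero])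
    obtain ⟨a, b, rfl⟩ := hm c ((hpm c).1 (hpc ▸ zero_mem _))
    have hax : a * x = 0 := hinj _ (by simpa [hyp] using hpc) (by simp [hxq])
    exact Ideal.mem_span_singleton'.2 ⟨b, by rw [hax, zero_add]⟩
  · have hqc : q c = 0 := ht₀ _ (by rw [← hyq, ← map_mul, hc, map_zero])
    obtain ⟨a, b, rfl⟩ := hm c ((hqm c).1 (hqc ▸ zero_mem _))
    have hby : b * y = 0 := hinj _ (by simp [hyp]) (by simpa [hxq] using hqc)
    exact Ideal.mem_span_singleton'.2 ⟨a, by rw [hby, add_zero]⟩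

end FiberProduct

/-- Corollary: Gorenstein local rings with decomposable maximal ideal are exactly the
dimension-1 hypersurfaces with decomposable maximal ideal, i.e. the fiber products of
two discrete valuation rings. -/
theorem gorenstein_decomposable_characterization
    (R : Type) [CommRing R] [IsNoetherianRing R] [IsLocalRing R] :
    ((HasDecomposableMaxIdeal R ∧ IsGorensteinLocal R) ↔
      (HasDecomposableMaxIdeal R ∧ IsHypersurfaceLocal R ∧
        ringKrullDim R = (1 : WithBot ℕ∞))) ∧
    ((HasDecomposableMaxIdeal R ∧ IsGorensteinLocal R) ↔
      (∃ (k S T : Type) (_ : Field k) (_ : CommRing S) (_ : IsNoetherianRing S)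
        (_ : IsLocalRing S) (_ : CommRing T) (_ : IsNoetherianRing T) (_ : IsLocalRing T)
        (πS : S →+* k) (πT : T →+* k),
        IsResidueSurjection πS ∧ IsResidueSurjection πT ∧
        Nonempty (R ≃+* ↥(fiberProduct πS πT)) ∧
        IsRegularLocal S ∧ ringKrullDim S = (1 : WithBot ℕ∞) ∧
        IsRegularLocal T ∧ ringKrullDim T = (1 : WithBot ℕ∞))) := by
  have hG : (HasDecomposableMaxIdeal R ∧ IsGorensteinLocal R) ↔ ∃ x y : R, IsNodalPair x y :=
    ⟨fun h ↦ exists_isNodalPair_of_isGorensteinLocal h.1 h.2,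
      fun ⟨_, _, h⟩ ↦ ⟨h.hasDecomposableMaxIdeal, h.isGorensteinLocal⟩⟩
  rw [hG]
  refine ⟨⟨?_, ?_⟩, ⟨?_, ?_⟩⟩
  · rintro ⟨x, y, h⟩
    exact ⟨h.hasDecomposableMaxIdeal, h.isHypersurfaceLocal, h.ringKrullDim_eq_one⟩
  · rintro ⟨hdec, hR, -⟩
    exact exists_isNodalPair_of_isHypersurfaceLocal hdec hR
  · rintro ⟨x, y, h⟩
    have hS := h.isLocalRing_quotient
    have hT := h.symm.isLocalRing_quotient
    exact ⟨ResidueField R, R ⧸ Ideal.span {y}, R ⧸ Ideal.span {x}, inferInstance, inferInstance,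
      inferInstance, hS, inferInstance, inferInstance, hT, h.quotientResidue,
      h.symm.quotientResidue, h.isResidueSurjection_quotientResidue,
      h.symm.isResidueSurjection_quotientResidue, h.nonempty_ringEquiv_fiberProduct,
      h.isRegularLocal_quotient.1, h.isRegularLocal_quotient.2,
      h.symm.isRegularLocal_quotient.1, h.symm.isRegularLocal_quotient.2⟩
  · rintro ⟨k, S, T, _, _, _, _, _, _, _, πS, πT, hπS, hπT, ⟨e⟩, hS, hSdim, hT, hTdim⟩
    obtain ⟨s, hs, hs₀⟩ := hS.exists_generator hSdim
    obtain ⟨t, ht, ht₀⟩ := hT.exists_generator hTdim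
    exact exists_isNodalPair_of_ringEquiv_fiberProduct hπS hπT e hs hs₀ ht ht₀
end

section
/- Let R ≅ S ×_k T be a non-trivial fiber product of local rings (S, m_S, k) and (T, m_T, k) with depth(S) ≥ 1 and depth(T) ≥ 1 (equivalently depth(R) ≥ 1). Then there is a natural R-module isomorphism R̃ ≅ S̃ × T̃, where for a local ring A, Ã denotes the integral closure of A in its total quotient ring Q(A). -/
/-! Common definitions for formalizing Nasseh–Sather-Wagstaff–Takahashi–VandeBogert,
"Applications and homological properties of local rings with decomposable maximal ideals". -/

open CategoryTheory IsLocalRing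

/-- `Ext^0(M, N)` is isomorphic to `Hom(M, N)`. -/
lemma nonempty_extGrp_zero_iso (R : Type u) [CommRing R]
    (M N : Type u) [AddCommGroup M] [Module R M] [AddCommGroup N] [Module R N] :
    Nonempty (extGrp R 0 M N ≅ ModuleCat.of R (ModuleCat.of R M ⟶ ModuleCat.of R N)) := by
  let F := (linearYoneda R (ModuleCat.{u} R)).obj (ModuleCat.of R N)
  have : Limits.PreservesLimits (F ⋙ forget (ModuleCat.{u} R)) :=
    inferInstanceAs (Limits.PreservesLimits (yoneda.obj (ModuleCat.of R N)))
  have : Limits.PreservesLimits F :=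
    Limits.preservesLimits_of_reflects_of_preserves F (forget (ModuleCat.{u} R))
  have : Limits.PreservesFiniteColimits F.rightOp := Limits.preservesFiniteColimits_rightOp F
  exact ⟨((F.rightOp.leftDerivedZeroIsoSelf.app (ModuleCat.of R M)).unop).symm⟩

lemma exists_mem_maximalIdeal_nonZeroDivisors_of_one_le_moduleDepth
    (A : Type u) [CommRing A] [IsNoetherianRing A] [IsLocalRing A]
    (h : 1 ≤ moduleDepth A A) : ∃ a ∈ maximalIdeal A, a ∈ nonZeroDivisors A := by
  have hext : Subsingleton (extGrp A 0 (ResidueField A) A) := by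
    by_contra hn
    have h0 : moduleDepth A A ≤ 0 := sInf_le ⟨0, by simp, hn⟩
    exact absurd (h.trans h0) (by simp)
  obtain ⟨i⟩ := nonempty_extGrp_zero_iso A (ResidueField A) A
  have hhom : Subsingleton (ModuleCat.of A (ResidueField A) ⟶ ModuleCat.of A A) :=
    i.toLinearEquiv.symm.injective.subsingleton
  by_contra! hz
  obtain ⟨-, x, hx, hx0⟩ := SetLike.lt_iff_le_and_exists.mp
    (Ideal.bot_lt_annihilator_of_disjoint_nonZeroDivisors
      (I := maximalIdeal A) (Set.disjoint_left.mpr hz))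
  let f : ResidueField A →ₗ[A] A := (maximalIdeal A).liftQ (LinearMap.toSpanSingleton A A x) <| by
    intro a ha
    simpa [mul_comm] using Module.mem_annihilator.mp hx ⟨a, ha⟩
  have hf : f = 0 := by
    simpa using congrArg ModuleCat.Hom.hom
      (Subsingleton.elim (ModuleCat.ofHom f) (ModuleCat.ofHom 0))
  apply hx0
  have h1 : f (residue A 1) = x := one_smul A x
  rw [← h1, hf, LinearMap.zero_apply]
  exact zero_mem _

section FiberProduct

variable {S T k : Type u} [CommRing S] [CommRing T] [Field k] {πS : S →+* k} {πT : T →+* k}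

lemma mem_fiberProduct_iff {x : S × T} : x ∈ fiberProduct πS πT ↔ πS x.1 = πT x.2 := Iff.rfl

lemma fiberProduct_fst_surjective (hT : Function.Surjective πT) :
    Function.Surjective ((RingHom.fst S T).comp (fiberProduct πS πT).subtype) := fun s ↦
  let ⟨t, ht⟩ := hT (πS s)
  ⟨⟨(s, t), ht.symm⟩, rfl⟩

lemma fiberProduct_snd_surjective (hS : Function.Surjective πS) :
    Function.Surjective ((RingHom.snd S T).comp (fiberProduct πS πT).subtype) := fun t ↦
  let ⟨s, hs⟩ := hS (πT t)
  ⟨⟨(s, t), hs⟩, rfl⟩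

lemma mem_nonZeroDivisors_fiberProduct_iff {a : S} {b : T}
    (ha : πS a = 0) (ha' : a ∈ nonZeroDivisors S) (hb : πT b = 0) (hb' : b ∈ nonZeroDivisors T)
    (r : fiberProduct πS πT) : r ∈ nonZeroDivisors (fiberProduct πS πT) ↔
      (r : S × T).1 ∈ nonZeroDivisors S ∧ (r : S × T).2 ∈ nonZeroDivisors T := by
  simp only [mem_nonZeroDivisors_iff_right] at ha' hb' ⊢
  refine ⟨fun h ↦ ⟨fun x hx ↦ ha' x ?_, fun y hy ↦ hb' y ?_⟩, fun h z hz ↦ ?_⟩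
  · have := h ⟨(x * a, 0), by simp [mem_fiberProduct_iff, ha]⟩
      (Subtype.ext (Prod.ext ((mul_right_comm _ _ _).trans (by rw [hx, zero_mul]; rfl)) (by simp)))
    exact congrArg (fun z : fiberProduct πS πT ↦ (z : S × T).1) this
  · have := h ⟨(0, y * b), by simp [mem_fiberProduct_iff, hb]⟩
      (Subtype.ext (Prod.ext (by simp) ((mul_right_comm _ _ _).trans (by rw [hy, zero_mul]; rfl))))
    exact congrArg (fun z : fiberProduct πS πT ↦ (z : S × T).2) this
  · exact Subtype.ext (Prod.ext (h.1 _ (congrArg (fun z : fiberProduct πS πT ↦ (z : S × T).1) hz))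
      (h.2 _ (congrArg (fun z : fiberProduct πS πT ↦ (z : S × T).2) hz)))

/-- The product of the total quotient rings is the total quotient ring of the fiber product. -/
lemma isFractionRing_fiberProduct_prod {a : S} {b : T}
    (ha : πS a = 0) (ha' : a ∈ nonZeroDivisors S) (hb : πT b = 0) (hb' : b ∈ nonZeroDivisors T)
    (QS QT : Type u) [CommRing QS] [CommRing QT]
    [Algebra S QS] [IsFractionRing S QS] [Algebra T QT] [IsFractionRing T QT]
    [Algebra (fiberProduct πS πT) (QS × QT)]
    (halg : ∀ r : fiberProduct πS πT, algebraMap (fiberProduct πS πT) (QS × QT) r =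
      (algebraMap S QS (r : S × T).1, algebraMap T QT (r : S × T).2)) :
    IsFractionRing (fiberProduct πS πT) (QS × QT) := by
  have hnzd := mem_nonZeroDivisors_fiberProduct_iff ha ha' hb hb'
  refine (isLocalization_iff _ _).mpr ⟨fun y ↦ ?_, fun z ↦ ?_, fun {x y} hxy ↦ ⟨1, ?_⟩⟩
  · rw [halg, Prod.isUnit_iff]
    have := (hnzd y).mp y.2
    exact ⟨IsLocalization.map_units QS ⟨_, this.1⟩, IsLocalization.map_units QT ⟨_, this.2⟩⟩
  · obtain ⟨⟨s, s'⟩, hs⟩ := IsLocalization.surj (nonZeroDivisors S) z.1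
    obtain ⟨⟨t, t'⟩, ht⟩ := IsLocalization.surj (nonZeroDivisors T) z.2
    refine ⟨⟨⟨(s * a, t * b), by simp [mem_fiberProduct_iff, ha, hb]⟩,
      ⟨⟨(s' * a, t' * b), by simp [mem_fiberProduct_iff, ha, hb]⟩,
        (hnzd _).mpr ⟨mul_mem s'.2 ha', mul_mem t'.2 hb'⟩⟩⟩, ?_⟩
    simp only [halg, map_mul]
    exact Prod.ext (by simp [← hs, mul_assoc]) (by simp [← ht, mul_assoc])
  · rw [halg, halg, Prod.mk.injEq] at hxy
    have : x = y := Subtype.ext (Prod.ext (IsFractionRing.injective S QS hxy.1)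
      (IsFractionRing.injective T QT hxy.2))
    rw [this]

end FiberProduct

/-- Integrality over the source of a surjection agrees with integrality over its target. -/
lemma isIntegral_iff_of_algebraMap_surjective {R S A : Type*} [CommRing R] [CommRing S]
    [CommRing A] [Algebra R S] [Algebra S A] [Algebra R A] [IsScalarTower R S A]
    (h : Function.Surjective (algebraMap R S)) {x : A} : IsIntegral R x ↔ IsIntegral S x :=
  have := Algebra.isIntegral_of_surjective h
  ⟨fun hx ↦ hx.tower_top, fun hx ↦ isIntegral_trans x hx⟩

set_option synthInstance.maxHeartbeats 1000000 in
set_option maxHeartbeats 1000000 in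
/-- Lemma: for a non-trivial fiber product `R = S ×_k T` of positive depth, the integral
closure of `R` in its total quotient ring is naturally isomorphic, as an `R`-module, to
`S̃ × T̃`. Here the total quotient rings are taken abstractly via `IsFractionRing`
(localization at the non-zero-divisors). -/
theorem integralClosure_fiberProduct
    (k S T : Type) [Field k] [CommRing S] [IsNoetherianRing S] [IsLocalRing S]
    [CommRing T] [IsNoetherianRing T] [IsLocalRing T]
    (πS : S →+* k) (πT : T →+* k)
    (hπS : IsResidueSurjection πS) (hπT : IsResidueSurjection πT)
    (hSnt : IsLocalRing.maximalIdeal S ≠ ⊥) (hTnt : IsLocalRing.maximalIdeal T ≠ ⊥)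
    (hdS : 1 ≤ moduleDepth S S) (hdT : 1 ≤ moduleDepth T T)
    (QR QS QT : Type) [CommRing QR] [CommRing QS] [CommRing QT]
    [Algebra ↥(fiberProduct πS πT) QR] [IsFractionRing ↥(fiberProduct πS πT) QR]
    [Algebra S QS] [IsFractionRing S QS]
    [Algebra T QT] [IsFractionRing T QT] :
    ∃ e : ↥(integralClosure ↥(fiberProduct πS πT) QR) ≃+
        (↥(integralClosure S QS) × ↥(integralClosure T QT)),
      ∀ (r : ↥(fiberProduct πS πT)) (x : ↥(integralClosure ↥(fiberProduct πS πT) QR)),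
        e (r • x) = ((r : S × T).1 • (e x).1, (r : S × T).2 • (e x).2) := by
  obtain ⟨a, ham, ha⟩ := exists_mem_maximalIdeal_nonZeroDivisors_of_one_le_moduleDepth S hdS
  obtain ⟨b, hbm, hb⟩ := exists_mem_maximalIdeal_nonZeroDivisors_of_one_le_moduleDepth T hdT
  rw [← hπS.2, RingHom.mem_ker] at ham
  rw [← hπT.2, RingHom.mem_ker] at hbm
  let pS : fiberProduct πS πT →+* S := (RingHom.fst S T).comp (fiberProduct πS πT).subtype
  let pT : fiberProduct πS πT →+* T := (RingHom.snd S T).comp (fiberProduct πS πT).subtype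
  let _ : Algebra (fiberProduct πS πT) S := pS.toAlgebra
  let _ : Algebra (fiberProduct πS πT) T := pT.toAlgebra
  let _ : Algebra (fiberProduct πS πT) QS := ((algebraMap S QS).comp pS).toAlgebra
  let _ : Algebra (fiberProduct πS πT) QT := ((algebraMap T QT).comp pT).toAlgebra
  have : IsScalarTower (fiberProduct πS πT) S QS := .of_algebraMap_eq fun _ ↦ rfl
  have : IsScalarTower (fiberProduct πS πT) T QT := .of_algebraMap_eq fun _ ↦ rfl
  have : IsFractionRing (fiberProduct πS πT) (QS × QT) :=
    isFractionRing_fiberProduct_prod ham ha hbm hb QS QT fun _ ↦ rfl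
  let φ : QR ≃ₐ[fiberProduct πS πT] QS × QT :=
    IsLocalization.algEquiv (nonZeroDivisors (fiberProduct πS πT)) QR (QS × QT)
  have hint (x : QR) : IsIntegral (fiberProduct πS πT) x ↔
      IsIntegral S (φ x).1 ∧ IsIntegral T (φ x).2 := by
    rw [← isIntegral_algEquiv φ, IsIntegral.pair_iff,
      isIntegral_iff_of_algebraMap_surjective (R := fiberProduct πS πT) (S := S)
        (fiberProduct_fst_surjective hπT.1),
      isIntegral_iff_of_algebraMap_surjective (R := fiberProduct πS πT) (S := T)
        (fiberProduct_snd_surjective hπS.1)]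
  refine ⟨{ toFun := fun x ↦ (⟨(φ x).1, ((hint x).mp x.2).1⟩, ⟨(φ x).2, ((hint x).mp x.2).2⟩)
            invFun := fun y ↦ ⟨φ.symm (y.1, y.2), (hint _).mpr (by simpa using ⟨y.1.2, y.2.2⟩)⟩
            left_inv := fun x ↦ Subtype.ext (by simp)
            right_inv := fun y ↦ Prod.ext (Subtype.ext (by simp)) (Subtype.ext (by simp))
            map_add' := fun x y ↦
              Prod.ext (Subtype.ext (by simp)) (Subtype.ext (by simp)) }, fun r x ↦ ?_⟩
  have hr : φ (r • (x : QR)) = r • φ x := map_smul φ r _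
  exact Prod.ext (Subtype.ext ((congrArg Prod.fst hr).trans (algebraMap_smul S r (φ x).1).symm))
    (Subtype.ext ((congrArg Prod.snd hr).trans (algebraMap_smul T r (φ x).2).symm))
end

section
/- Let R ≅ S ×_k T be a non-trivial fiber product of local rings (S, m_S, k) and (T, m_T, k) with depth(S) ≥ 1 and depth(T) ≥ 1 (equivalently depth(R) ≥ 1). Then there is a natural R-module isomorphism (m_R·R̃ + R)/R ≅ ((m_S·S̃ + S)/S) ⊕ ((m_T·T̃ + T)/T). In particular, the R-module (m_R·R̃ + R)/R is cyclic if and only if (m_S·S̃ + S)/S and (m_T·T̃ + T)/T are both cyclic and one of them is zero. -/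
/-! Common definitions for formalizing Nasseh–Sather-Wagstaff–Takahashi–VandeBogert,
"Applications and homological properties of local rings with decomposable maximal ideals". -/

open CategoryTheory IsLocalRing

/-- The image of `A` in (an abstract copy of) its total quotient ring, as a submodule. -/
noncomputable def algSub (A : Type) [CommRing A] (Q : Type) [CommRing Q] [Algebra A Q] :
    Submodule A Q :=
  LinearMap.range (Algebra.linearMap A Q)

/-- The `A`-module `(m_A·Ã + A)/A`, realized as the image of `m_A·Ã` in `Q(A)/A`. -/
noncomputable def conductorTypeMod (A : Type) [CommRing A] [IsLocalRing A]
    (Q : Type) [CommRing Q] [Algebra A Q] : Submodule A (Q ⧸ algSub A Q) :=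
  Submodule.map (algSub A Q).mkQ
    ((IsLocalRing.maximalIdeal A) • (Subalgebra.toSubmodule (integralClosure A Q)))

universe u

instance preservesFiniteLimits_linearYoneda_obj (R : Type u) [CommRing R] (Y : ModuleCat.{u} R) :
    Limits.PreservesFiniteLimits ((linearYoneda R (ModuleCat.{u} R)).obj Y) := by
  have : Limits.PreservesFiniteLimits
      ((linearYoneda R (ModuleCat.{u} R)).obj Y ⋙ forget (ModuleCat.{u} R)) :=
    inferInstanceAs (Limits.PreservesFiniteLimits (yoneda.obj Y))
  exact Limits.preservesFiniteLimits_of_reflects_of_preserves _ (forget (ModuleCat.{u} R))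

/-- `Ext⁰` is `Hom`. -/
noncomputable def extGrpZeroIso (R : Type u) [CommRing R]
    (M N : Type u) [AddCommGroup M] [Module R M] [AddCommGroup N] [Module R N] :
    extGrp R 0 M N ≅ ((linearYoneda R (ModuleCat.{u} R)).obj (ModuleCat.of R N)).obj
      (Opposite.op (ModuleCat.of R M)) :=
  haveI := Limits.preservesFiniteColimits_rightOp
    ((linearYoneda R (ModuleCat.{u} R)).obj (ModuleCat.of R N))
  ((((linearYoneda R (ModuleCat.{u} R)).obj (ModuleCat.of R N)).rightOp.leftDerivedZeroIsoSelf).app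
    (ModuleCat.of R M)).unop.symm

theorem subsingleton_linearMap_of_one_le_moduleDepth (R : Type u) [CommRing R] [IsLocalRing R]
    (M : Type u) [AddCommGroup M] [Module R M] (h : 1 ≤ moduleDepth R M) :
    Subsingleton (ResidueField R →ₗ[R] M) := by
  have h0 : Subsingleton (extGrp R 0 (ResidueField R) M) := by
    by_contra hn
    have : moduleDepth R M ≤ ((0 : ℕ) : ℕ∞) := sInf_le ⟨0, rfl, hn⟩
    exact absurd (h.trans this) (by simp)
  have e := (extGrpZeroIso R (ResidueField R) M).toLinearEquiv
  have h1 : Subsingleton (ModuleCat.of R (ResidueField R) ⟶ ModuleCat.of R M) :=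
    e.symm.toEquiv.subsingleton
  exact (ModuleCat.homEquiv (M := ModuleCat.of R (ResidueField R))
    (N := ModuleCat.of R M)).symm.subsingleton

theorem exists_mem_nonZeroDivisors_of_one_le_moduleDepth (R : Type u) [CommRing R]
    [IsLocalRing R] [IsNoetherianRing R] (h : 1 ≤ moduleDepth R R) :
    ∃ a ∈ maximalIdeal R, a ∈ nonZeroDivisors R := by
  have hs := subsingleton_linearMap_of_one_le_moduleDepth R R h
  by_contra! hn
  have hd : Disjoint (maximalIdeal R : Set R) (nonZeroDivisors R) :=
    Set.disjoint_left.mpr hn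
  obtain ⟨x, hx, hx0⟩ :=
    SetLike.exists_of_lt (Ideal.bot_lt_annihilator_of_disjoint_nonZeroDivisors hd)
  have hle : maximalIdeal R ≤ LinearMap.ker (LinearMap.toSpanSingleton R R x) := by
    intro y hy
    have := Module.mem_annihilator.mp hx ⟨y, hy⟩
    simpa [Subtype.ext_iff, mul_comm] using this
  let f : ResidueField R →ₗ[R] R :=
    Submodule.liftQ (maximalIdeal R) (LinearMap.toSpanSingleton R R x) hle
  have hf : LinearMap.toSpanSingleton R R x 1 = 0 :=
    DFunLike.congr_fun (Subsingleton.elim f 0) (residue R 1)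
  rw [LinearMap.toSpanSingleton_apply, one_smul] at hf
  exact hx0 hf

/-- The ideal extended from the maximal ideal to the integral closure in `Q`. -/
abbrev extendedMaxIdeal (A : Type) [CommRing A] [IsLocalRing A]
    (Q : Type) [CommRing Q] [Algebra A Q] : Submodule A Q :=
  maximalIdeal A • Subalgebra.toSubmodule (integralClosure A Q)

theorem mem_maximalIdeal_of_algebraMap_mem_extendedMaxIdeal {A Q : Type} [CommRing A]
    [IsLocalRing A] [CommRing Q] [Algebra A Q] (hinj : Function.Injective (algebraMap A Q))
    {a : A} (ha : algebraMap A Q a ∈ extendedMaxIdeal A Q) : a ∈ maximalIdeal A := by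
  have hinj' : Function.Injective (algebraMap A (integralClosure A Q)) := fun x y h =>
    hinj (congrArg Subtype.val h)
  obtain ⟨P, hP, hcomap⟩ := Ideal.exists_ideal_over_maximal_of_isIntegral
    (S := integralClosure A Q) (maximalIdeal A)
    (by rw [(RingHom.injective_iff_ker_eq_bot _).mp hinj']; exact bot_le)
  have key : ∀ x ∈ extendedMaxIdeal A Q, ∃ y ∈ P, (y : Q) = x := by
    intro x hx
    induction hx using Submodule.smul_induction_on' with
    | smul r hr n hn =>
      refine ⟨algebraMap A (integralClosure A Q) r * ⟨n, hn⟩, P.mul_mem_right _ ?_, ?_⟩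
      · rwa [← Ideal.mem_comap, hcomap]
      · rw [Algebra.smul_def]; rfl
    | add x _ y _ hx hy =>
      obtain ⟨x', hx', rfl⟩ := hx
      obtain ⟨y', hy', rfl⟩ := hy
      exact ⟨x' + y', P.add_mem hx' hy', rfl⟩
  obtain ⟨y, hy, hya⟩ := key _ ha
  rw [← hcomap, Ideal.mem_comap]
  rwa [show algebraMap A (integralClosure A Q) a = y from Subtype.ext hya.symm]

theorem isIntegral_fst_of_ringEquiv_prod {R S T QR QS QT : Type} [CommRing R] [CommRing S]
    [CommRing T] [CommRing QR] [CommRing QS] [CommRing QT] [Algebra R QR] [Algebra S QS]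
    [Algebra T QT] {f : R →+* S} {g : R →+* T} {φ : QR ≃+* QS × QT}
    (hφ : ∀ r, φ (algebraMap R QR r) = (algebraMap S QS (f r), algebraMap T QT (g r)))
    {x : QR} (hx : IsIntegral R x) : IsIntegral S (φ x).1 :=
  hx.map_of_comp_eq f ((RingHom.fst QS QT).comp φ.toRingHom)
    (RingHom.ext fun r => (congrArg Prod.fst (hφ r)).symm)

/-- The properties of the projections of a fiber product of local rings over their common residue
field that determine how the total quotient rings and integral closures are related. -/
structure IsLocalFiberProduct {R S T : Type} [CommRing R] [IsLocalRing R] [CommRing S]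
    [IsLocalRing S] [CommRing T] [IsLocalRing T] (f : R →+* S) (g : R →+* T) : Prop where
  surjective_left : Function.Surjective f
  surjective_right : Function.Surjective g
  eq_zero : ∀ r, f r = 0 → g r = 0 → r = 0
  exists_lift : ∀ s ∈ maximalIdeal S, ∀ t ∈ maximalIdeal T,
    ∃ r ∈ maximalIdeal R, f r = s ∧ g r = t
  map_left : ∀ r ∈ maximalIdeal R, f r ∈ maximalIdeal S
  map_right : ∀ r ∈ maximalIdeal R, g r ∈ maximalIdeal T

namespace IsLocalFiberProduct

section

variable {R S T : Type} [CommRing R] [IsLocalRing R] [CommRing S]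
    [IsLocalRing S] [CommRing T] [IsLocalRing T] {f : R →+* S} {g : R →+* T}

theorem symm (h : IsLocalFiberProduct f g) : IsLocalFiberProduct g f where
  surjective_left := h.surjective_right
  surjective_right := h.surjective_left
  eq_zero r h1 h2 := h.eq_zero r h2 h1
  exists_lift t ht s hs := by
    obtain ⟨r, hr, h1, h2⟩ := h.exists_lift s hs t ht
    exact ⟨r, hr, h2, h1⟩
  map_left := h.map_right
  map_right := h.map_left

theorem map_mem_nonZeroDivisors (h : IsLocalFiberProduct f g) {a : S} (ha : a ∈ maximalIdeal S)
    (ha' : a ∈ nonZeroDivisors S) {r : R} (hr : r ∈ nonZeroDivisors R) :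
    f r ∈ nonZeroDivisors S := by
  rw [mem_nonZeroDivisors_iff_right] at ha' hr ⊢
  intro x hx
  obtain ⟨c, -, hc1, hc2⟩ := h.exists_lift (x * a) (Ideal.mul_mem_left _ _ ha) 0 (zero_mem _)
  have : c = 0 := hr c <| h.eq_zero _ (by rw [map_mul, hc1, mul_right_comm, hx, zero_mul])
    (by rw [map_mul, hc2, zero_mul])
  exact ha' x (by rw [← hc1, this, map_zero])

theorem mem_nonZeroDivisors (h : IsLocalFiberProduct f g) {r : R}
    (h1 : f r ∈ nonZeroDivisors S) (h2 : g r ∈ nonZeroDivisors T) : r ∈ nonZeroDivisors R := by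
  rw [mem_nonZeroDivisors_iff_right] at h1 h2 ⊢
  intro x hx
  exact h.eq_zero x (h1 _ (by rw [← map_mul, hx, map_zero]))
    (h2 _ (by rw [← map_mul, hx, map_zero]))

/-- The total quotient ring of the fiber product is the product of the total quotient rings. -/
theorem exists_ringEquiv_prod (h : IsLocalFiberProduct f g)
    {a : S} (ha : a ∈ maximalIdeal S) (ha' : a ∈ nonZeroDivisors S)
    {b : T} (hb : b ∈ maximalIdeal T) (hb' : b ∈ nonZeroDivisors T)
    (QR QS QT : Type) [CommRing QR] [CommRing QS] [CommRing QT]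
    [Algebra R QR] [IsFractionRing R QR] [Algebra S QS] [IsFractionRing S QS]
    [Algebra T QT] [IsFractionRing T QT] :
    ∃ φ : QR ≃+* QS × QT, ∀ r, φ (algebraMap R QR r) =
      (algebraMap S QS (f r), algebraMap T QT (g r)) := by
  let _ : Algebra R (QS × QT) :=
    (((algebraMap S QS).comp f).prod ((algebraMap T QT).comp g)).toAlgebra
  have hmap : ∀ r, algebraMap R (QS × QT) r = (algebraMap S QS (f r), algebraMap T QT (g r)) :=
    fun _ => rfl
  have hloc : IsFractionRing R (QS × QT) := by
    refine ⟨?_, ?_, ?_⟩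
    · rintro ⟨r, hr⟩
      rw [hmap, Prod.isUnit_iff]
      exact ⟨IsLocalization.map_units QS ⟨_, h.map_mem_nonZeroDivisors ha ha' hr⟩,
        IsLocalization.map_units QT ⟨_, h.symm.map_mem_nonZeroDivisors hb hb' hr⟩⟩
    · rintro ⟨x, y⟩
      obtain ⟨⟨s, s'⟩, hs⟩ := IsLocalization.surj (nonZeroDivisors S) x
      obtain ⟨⟨t, t'⟩, ht⟩ := IsLocalization.surj (nonZeroDivisors T) y
      obtain ⟨r, -, hr1, hr2⟩ := h.exists_lift (s * a) (Ideal.mul_mem_left _ _ ha)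
        (t * b) (Ideal.mul_mem_left _ _ hb)
      obtain ⟨r', -, hr1', hr2'⟩ := h.exists_lift (s' * a) (Ideal.mul_mem_left _ _ ha)
        (t' * b) (Ideal.mul_mem_left _ _ hb)
      refine ⟨(r, ⟨r', h.mem_nonZeroDivisors (hr1' ▸ mul_mem s'.2 ha')
        (hr2' ▸ mul_mem t'.2 hb')⟩), ?_⟩
      simp only [hmap, hr1, hr2, hr1', hr2', Prod.mk_mul_mk, map_mul, ← mul_assoc, hs, ht]
    · intro x y hxy
      simp only [hmap, Prod.mk.injEq] at hxy
      refine ⟨1, ?_⟩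
      have h1 := IsFractionRing.injective S QS hxy.1
      have h2 := IsFractionRing.injective T QT hxy.2
      rw [sub_eq_zero.mp (h.eq_zero (x - y) (by simp [h1]) (by simp [h2]))]
  let φ : QR ≃ₐ[R] QS × QT := IsLocalization.algEquiv (nonZeroDivisors R) QR (QS × QT)
  exact ⟨φ.toRingEquiv, fun r => φ.commutes r⟩

end

section

variable {R S T QR QS QT : Type} [CommRing R] [IsLocalRing R] [CommRing S]
    [IsLocalRing S] [CommRing T] [IsLocalRing T] {f : R →+* S} {g : R →+* T}
    [CommRing QR] [CommRing QS] [CommRing QT] [Algebra R QR] [Algebra S QS] [Algebra T QT]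
    {φ : QR ≃+* QS × QT}

theorem isIntegral_symm_left (h : IsLocalFiberProduct f g) (hφ : ∀ r, φ (algebraMap R QR r) =
    (algebraMap S QS (f r), algebraMap T QT (g r))) {x : QS} (hx : IsIntegral S x) :
    IsIntegral R (φ.symm (x, 0)) := by
  obtain ⟨p, hp, hpx⟩ := hx
  obtain ⟨q, hq, -, hqm⟩ := Polynomial.lifts_and_natDegree_eq_and_monic
    (f := f) ((Polynomial.mem_lifts p).mpr (Polynomial.map_surjective f h.surjective_left p)) hp
  refine ⟨Polynomial.X * q, Polynomial.monic_X.mul hqm, φ.injective ?_⟩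
  rw [map_zero, Polynomial.eval₂_mul, Polynomial.eval₂_X, map_mul, φ.apply_symm_apply]
  have : (φ (Polynomial.eval₂ (algebraMap R QR) (φ.symm (x, 0)) q)).1 = 0 := by
    have h1 := Polynomial.hom_eval₂ q (algebraMap R QR)
      ((RingHom.fst QS QT).comp φ.toRingHom) (φ.symm (x, 0))
    have h2 : ((RingHom.fst QS QT).comp φ.toRingHom).comp (algebraMap R QR) =
        (algebraMap S QS).comp f := RingHom.ext fun r => congrArg Prod.fst (hφ r)
    rw [h2, ← Polynomial.eval₂_map, hq] at h1
    have h3 : ((RingHom.fst QS QT).comp φ.toRingHom) (φ.symm (x, 0)) = x :=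
      congrArg Prod.fst (φ.apply_symm_apply (x, 0))
    rw [h3, hpx] at h1
    exact h1
  ext
  · rw [Prod.fst_mul, this, mul_zero]; rfl
  · rw [Prod.snd_mul, zero_mul]; rfl

theorem fst_mem_extendedMaxIdeal (h : IsLocalFiberProduct f g)
    (hφ : ∀ r, φ (algebraMap R QR r) = (algebraMap S QS (f r), algebraMap T QT (g r)))
    {x : QR} (hx : x ∈ extendedMaxIdeal R QR) : (φ x).1 ∈ extendedMaxIdeal S QS := by
  induction hx using Submodule.smul_induction_on' with
  | smul r hr n hn =>
    rw [Algebra.smul_def, map_mul, hφ, Prod.fst_mul, ← Algebra.smul_def]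
    exact Submodule.smul_mem_smul (h.map_left r hr) (isIntegral_fst_of_ringEquiv_prod hφ hn)
  | add x _ y _ hx hy =>
    rw [map_add, Prod.fst_add]
    exact add_mem hx hy

theorem symm_left_mem_extendedMaxIdeal (h : IsLocalFiberProduct f g)
    (hφ : ∀ r, φ (algebraMap R QR r) = (algebraMap S QS (f r), algebraMap T QT (g r)))
    {x : QS} (hx : x ∈ extendedMaxIdeal S QS) : φ.symm (x, 0) ∈ extendedMaxIdeal R QR := by
  induction hx using Submodule.smul_induction_on' with
  | smul s hs n hn =>
    obtain ⟨r, hr, hr1, -⟩ := h.exists_lift s hs 0 (zero_mem _)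
    have : φ.symm (s • n, 0) = r • φ.symm (n, 0) := by
      apply φ.injective
      rw [Algebra.smul_def, Algebra.smul_def, map_mul, hφ, φ.apply_symm_apply,
        φ.apply_symm_apply, Prod.mk_mul_mk, hr1, mul_zero]
    rw [this]
    exact Submodule.smul_mem_smul hr (h.isIntegral_symm_left hφ hn)
  | add x _ y _ hx hy =>
    rw [show ((x + y, 0) : QS × QT) = (x, 0) + (y, 0) by simp, map_add]
    exact add_mem hx hy

theorem mem_extendedMaxIdeal_iff (h : IsLocalFiberProduct f g)
    (hφ : ∀ r, φ (algebraMap R QR r) = (algebraMap S QS (f r), algebraMap T QT (g r)))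
    {x : QR} : x ∈ extendedMaxIdeal R QR ↔
      (φ x).1 ∈ extendedMaxIdeal S QS ∧ (φ x).2 ∈ extendedMaxIdeal T QT := by
  have hφ' : ∀ r, (φ.trans RingEquiv.prodComm) (algebraMap R QR r) =
      (algebraMap T QT (g r), algebraMap S QS (f r)) := fun r => by
    rw [RingEquiv.trans_apply, hφ]; rfl
  refine ⟨fun hx => ⟨h.fst_mem_extendedMaxIdeal hφ hx,
    h.symm.fst_mem_extendedMaxIdeal hφ' hx⟩, fun ⟨h1, h2⟩ => ?_⟩
  have := add_mem (h.symm_left_mem_extendedMaxIdeal hφ h1)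
    (h.symm.symm_left_mem_extendedMaxIdeal hφ' h2)
  convert this
  apply φ.injective
  rw [map_add, φ.apply_symm_apply]
  have : φ ((φ.trans RingEquiv.prodComm).symm ((φ x).2, 0)) = (0, (φ x).2) :=
    φ.apply_symm_apply _
  rw [this]
  simp

/-- An element of the extended maximal ideal lies in the base ring as soon as its components do. -/
theorem mem_algSub_iff (h : IsLocalFiberProduct f g)
    (hS : Function.Injective (algebraMap S QS)) (hT : Function.Injective (algebraMap T QT))
    (hφ : ∀ r, φ (algebraMap R QR r) = (algebraMap S QS (f r), algebraMap T QT (g r)))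
    {x : QR} (hx : x ∈ extendedMaxIdeal R QR) :
    x ∈ algSub R QR ↔ (φ x).1 ∈ algSub S QS ∧ (φ x).2 ∈ algSub T QT := by
  constructor
  · rintro ⟨r, rfl⟩
    rw [Algebra.linearMap_apply, hφ]
    exact ⟨⟨f r, rfl⟩, ⟨g r, rfl⟩⟩
  · rintro ⟨⟨s, hs⟩, ⟨t, ht⟩⟩
    obtain ⟨h1, h2⟩ := (h.mem_extendedMaxIdeal_iff hφ).mp hx
    rw [Algebra.linearMap_apply] at hs ht
    obtain ⟨r, -, hr1, hr2⟩ := h.exists_lift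
      s (mem_maximalIdeal_of_algebraMap_mem_extendedMaxIdeal hS (hs ▸ h1))
      t (mem_maximalIdeal_of_algebraMap_mem_extendedMaxIdeal hT (ht ▸ h2))
    refine ⟨r, φ.injective ?_⟩
    rw [Algebra.linearMap_apply, hφ, hr1, hr2, hs, ht]

end

end IsLocalFiberProduct

/-- Two surjections with the same kernel have isomorphic targets. -/
theorem exists_addEquiv_of_ker_eq {W A B : Type} [AddCommGroup W] [AddCommGroup A]
    [AddCommGroup B] (p : W →+ A) (q : W →+ B) (hp : Function.Surjective p)
    (hq : Function.Surjective q) (hker : p.ker = q.ker) :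
    ∃ e : A ≃+ B, ∀ w, e (p w) = q w := by
  refine ⟨(QuotientAddGroup.quotientKerEquivOfSurjective p hp).symm.trans
    ((QuotientAddGroup.quotientAddEquivOfEq hker).trans
      (QuotientAddGroup.quotientKerEquivOfSurjective q hq)), fun w => ?_⟩
  have : (QuotientAddGroup.quotientKerEquivOfSurjective p hp).symm (p w) = (w : W ⧸ p.ker) := by
    rw [AddEquiv.symm_apply_eq]; rfl
  rw [AddEquiv.trans_apply, this]
  rfl

/-- The surjection from the extended maximal ideal onto `conductorTypeMod`. -/
noncomputable def toConductorTypeMod (A : Type) [CommRing A] [IsLocalRing A]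
    (Q : Type) [CommRing Q] [Algebra A Q] :
    extendedMaxIdeal A Q →ₗ[A] conductorTypeMod A Q :=
  (algSub A Q).mkQ.submoduleMap _

theorem toConductorTypeMod_surjective (A : Type) [CommRing A] [IsLocalRing A]
    (Q : Type) [CommRing Q] [Algebra A Q] : Function.Surjective (toConductorTypeMod A Q) :=
  (algSub A Q).mkQ.submoduleMap_surjective _

theorem toConductorTypeMod_eq_zero_iff {A : Type} [CommRing A] [IsLocalRing A]
    {Q : Type} [CommRing Q] [Algebra A Q] {x : extendedMaxIdeal A Q} :
    toConductorTypeMod A Q x = 0 ↔ (x : Q) ∈ algSub A Q := by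
  rw [← Submodule.Quotient.mk_eq_zero, Subtype.ext_iff]
  rfl

theorem IsLocalFiberProduct.exists_addEquiv_conductorTypeMod
    {R S T : Type} [CommRing R] [IsLocalRing R] [CommRing S]
    [IsLocalRing S] [CommRing T] [IsLocalRing T] {f : R →+* S} {g : R →+* T}
    (h : IsLocalFiberProduct f g) {QR QS QT : Type}
    [CommRing QR] [CommRing QS] [CommRing QT] [Algebra R QR] [Algebra S QS] [Algebra T QT]
    (hS : Function.Injective (algebraMap S QS)) (hT : Function.Injective (algebraMap T QT))
    {φ : QR ≃+* QS × QT}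
    (hφ : ∀ r, φ (algebraMap R QR r) = (algebraMap S QS (f r), algebraMap T QT (g r))) :
    ∃ e : conductorTypeMod R QR ≃+ conductorTypeMod S QS × conductorTypeMod T QT,
      ∀ (r : R) (x : conductorTypeMod R QR), e (r • x) = (f r • (e x).1, g r • (e x).2) := by
  have hmem := fun {x : QR} => h.mem_extendedMaxIdeal_iff hφ (x := x)
  let q : extendedMaxIdeal R QR →+ conductorTypeMod S QS × conductorTypeMod T QT :=
    { toFun := fun w => (toConductorTypeMod S QS ⟨_, (hmem.mp w.2).1⟩,
        toConductorTypeMod T QT ⟨_, (hmem.mp w.2).2⟩)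
      map_zero' := by
        ext1
        · exact toConductorTypeMod_eq_zero_iff.mpr (by simp)
        · exact toConductorTypeMod_eq_zero_iff.mpr (by simp)
      map_add' := fun v w => by
        ext1
        · rw [Prod.fst_add, ← map_add]; simp
        · rw [Prod.snd_add, ← map_add]; simp }
  have hq_smul : ∀ (r : R) w, q (r • w) = (f r • (q w).1, g r • (q w).2) := by
    intro r w
    ext1
    · change toConductorTypeMod S QS _ = f r • toConductorTypeMod S QS _
      rw [← map_smul]; congr 1; ext1; simp [Algebra.smul_def, hφ]
    · change toConductorTypeMod T QT _ = g r • toConductorTypeMod T QT _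
      rw [← map_smul]; congr 1; ext1; simp [Algebra.smul_def, hφ]
  have hq : Function.Surjective q := by
    rintro ⟨m, n⟩
    obtain ⟨⟨x, hx⟩, rfl⟩ := toConductorTypeMod_surjective S QS m
    obtain ⟨⟨y, hy⟩, rfl⟩ := toConductorTypeMod_surjective T QT n
    refine ⟨⟨φ.symm (x, y), hmem.mpr (by simpa using ⟨hx, hy⟩)⟩, ?_⟩
    ext1
    · change toConductorTypeMod S QS _ = _
      congr 1; ext1; simp
    · change toConductorTypeMod T QT _ = _
      congr 1; ext1; simp
  have hker : (toConductorTypeMod R QR).toAddMonoidHom.ker = q.ker := by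
    ext w
    rw [AddMonoidHom.mem_ker, AddMonoidHom.mem_ker, Prod.ext_iff]
    change toConductorTypeMod R QR w = 0 ↔
      toConductorTypeMod S QS _ = 0 ∧ toConductorTypeMod T QT _ = 0
    rw [toConductorTypeMod_eq_zero_iff, toConductorTypeMod_eq_zero_iff,
      toConductorTypeMod_eq_zero_iff, h.mem_algSub_iff hS hT hφ w.2]
  obtain ⟨e, he⟩ := exists_addEquiv_of_ker_eq (toConductorTypeMod R QR).toAddMonoidHom q
    (toConductorTypeMod_surjective R QR) hq hker
  refine ⟨e, fun r x => ?_⟩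
  obtain ⟨w, rfl⟩ := toConductorTypeMod_surjective R QR x
  have he' : ∀ w, e (toConductorTypeMod R QR w) = q w := he
  rw [← map_smul, he', he', hq_smul]

theorem Submodule.isPrincipal_iff_exists_generator {A M : Type} [CommRing A] [AddCommGroup M]
    [Module A M] {N : Submodule A M} :
    N.IsPrincipal ↔ ∃ a : N, ∀ x : N, ∃ r : A, r • a = x := by
  constructor
  · rintro ⟨a, rfl⟩
    refine ⟨⟨a, Submodule.mem_span_singleton_self a⟩, fun x => ?_⟩
    obtain ⟨r, hr⟩ := Submodule.mem_span_singleton.mp x.2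
    exact ⟨r, Subtype.ext hr⟩
  · rintro ⟨a, ha⟩
    refine ⟨a, le_antisymm (fun x hx => ?_) ?_⟩
    · obtain ⟨r, hr⟩ := ha ⟨x, hx⟩
      exact Submodule.mem_span_singleton.mpr ⟨r, congrArg Subtype.val hr⟩
    · exact (Submodule.span_singleton_le_iff_mem _ _).mpr a.2

theorem IsLocalFiberProduct.isPrincipal_iff
    {R S T : Type} [CommRing R] [IsLocalRing R] [CommRing S]
    [IsLocalRing S] [CommRing T] [IsLocalRing T] {f : R →+* S} {g : R →+* T}
    (h : IsLocalFiberProduct f g) {L M N : Type} [AddCommGroup L] [AddCommGroup M]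
    [AddCommGroup N] [Module R L] [Module S M] [Module T N] {A : Submodule R L}
    {B : Submodule S M} {C : Submodule T N} (e : A ≃+ B × C)
    (he : ∀ (r : R) (x : A), e (r • x) = (f r • (e x).1, g r • (e x).2)) :
    A.IsPrincipal ↔ B.IsPrincipal ∧ C.IsPrincipal ∧ (B = ⊥ ∨ C = ⊥) := by
  simp only [Submodule.isPrincipal_iff_exists_generator]
  constructor
  · rintro ⟨a, ha⟩
    have ha' : ∀ y : B × C, ∃ r : R, f r • (e a).1 = y.1 ∧ g r • (e a).2 = y.2 := by
      intro y
      obtain ⟨r, hr⟩ := ha (e.symm y)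
      have := congrArg e hr
      rw [he, e.apply_symm_apply] at this
      exact ⟨r, congrArg Prod.fst this, congrArg Prod.snd this⟩
    refine ⟨⟨(e a).1, fun x => ?_⟩, ⟨(e a).2, fun x => ?_⟩, ?_⟩
    · obtain ⟨r, hr, -⟩ := ha' (x, 0)
      exact ⟨f r, hr⟩
    · obtain ⟨r, -, hr⟩ := ha' (0, x)
      exact ⟨g r, hr⟩
    · obtain ⟨r, hr1, hr2⟩ := ha' ((e a).1, 0)
      dsimp only at hr1 hr2
      by_cases hr : r ∈ maximalIdeal R
      · left
        have hu : IsUnit (1 - f r) := by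
          by_contra hn
          exact (Ideal.ne_top_iff_one _).mp (maximalIdeal.isMaximal S).ne_top
            (by simpa using add_mem (show 1 - f r ∈ maximalIdeal S from hn) (h.map_left r hr))
        have hz : (e a).1 = 0 :=
          hu.smul_eq_zero.mp (by rw [sub_smul, one_smul, hr1, sub_self])
        rw [eq_bot_iff]
        intro x hx
        obtain ⟨r, hr, -⟩ := ha' (⟨x, hx⟩, 0)
        rw [hz, smul_zero] at hr
        exact (congrArg Subtype.val hr).symm
      · right
        have hu : IsUnit r := by simpa using hr
        have hz : (e a).2 = 0 := (hu.map g).smul_eq_zero.mp hr2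
        rw [eq_bot_iff]
        intro x hx
        obtain ⟨r, -, hr⟩ := ha' (0, ⟨x, hx⟩)
        rw [hz, smul_zero] at hr
        exact (congrArg Subtype.val hr).symm
  · rintro ⟨⟨u, hu⟩, ⟨v, hv⟩, h0⟩
    refine ⟨e.symm (u, v), fun x => ?_⟩
    obtain ⟨s, hs⟩ := hu (e x).1
    obtain ⟨t, ht⟩ := hv (e x).2
    rcases h0 with rfl | rfl
    · obtain ⟨r, hr⟩ := h.surjective_right t
      refine ⟨r, e.injective ?_⟩
      rw [he, e.apply_symm_apply]
      exact Prod.ext (Subsingleton.elim _ _) (by rw [hr]; exact ht)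
    · obtain ⟨r, hr⟩ := h.surjective_left s
      refine ⟨r, e.injective ?_⟩
      rw [he, e.apply_symm_apply]
      exact Prod.ext (by rw [hr]; exact hs) (Subsingleton.elim _ _)

theorem isUnit_fiberProduct_of_fst_ne_zero {k S T : Type} [Field k] [CommRing S] [IsLocalRing S]
    [CommRing T] [IsLocalRing T] {πS : S →+* k} {πT : T →+* k} (hπS : IsResidueSurjection πS)
    (hπT : IsResidueSurjection πT) {r : fiberProduct πS πT} (hr : πS (r : S × T).1 ≠ 0) :
    IsUnit r := by
  obtain ⟨⟨s, t⟩, hst⟩ := r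
  have hst' : πS s = πT t := hst
  have hs : IsUnit s := by
    by_contra hn
    exact hr (RingHom.mem_ker.mp (hπS.2 ▸ (show s ∈ maximalIdeal S from hn)))
  have ht : IsUnit t := by
    by_contra hn
    exact hr (hst'.trans (RingHom.mem_ker.mp (hπT.2 ▸ (show t ∈ maximalIdeal T from hn))))
  obtain ⟨s', hs'⟩ := hs.exists_right_inv
  obtain ⟨t', ht'⟩ := ht.exists_right_inv
  have hinv : πS s' = πT t' := by
    apply mul_left_cancel₀ hr
    change πS s * πS s' = πS s * πT t'
    rw [← map_mul, hs', hst', ← map_mul, ht', map_one, map_one]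
  exact IsUnit.of_mul_eq_one (⟨(s', t'), hinv⟩ : fiberProduct πS πT)
    (Subtype.ext (Prod.ext hs' ht'))

theorem isLocalFiberProduct_fiberProduct {k S T : Type} [Field k] [CommRing S] [IsLocalRing S]
    [CommRing T] [IsLocalRing T] {πS : S →+* k} {πT : T →+* k} (hπS : IsResidueSurjection πS)
    (hπT : IsResidueSurjection πT) [IsLocalRing (fiberProduct πS πT)] :
    IsLocalFiberProduct ((RingHom.fst S T).comp (fiberProduct πS πT).subtype)
      ((RingHom.snd S T).comp (fiberProduct πS πT).subtype) := by
  have hmem : ∀ r ∈ maximalIdeal (fiberProduct πS πT), πS (r : S × T).1 = 0 := by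
    intro r hr
    by_contra hn
    exact hr (isUnit_fiberProduct_of_fst_ne_zero hπS hπT hn)
  refine ⟨fun s => ?_, fun t => ?_, fun r h1 h2 => Subtype.ext (Prod.ext h1 h2),
    fun s hs t ht => ?_, fun r hr => ?_, fun r hr => ?_⟩
  · obtain ⟨t, ht⟩ := hπT.1 (πS s)
    exact ⟨⟨(s, t), ht.symm⟩, rfl⟩
  · obtain ⟨s, hs⟩ := hπS.1 (πT t)
    exact ⟨⟨(s, t), hs⟩, rfl⟩
  · have hs0 : πS s = 0 := RingHom.mem_ker.mp (hπS.2.symm ▸ hs)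
    have ht0 : πT t = 0 := RingHom.mem_ker.mp (hπT.2.symm ▸ ht)
    refine ⟨⟨(s, t), hs0.trans ht0.symm⟩, fun hu => hs ?_, rfl, rfl⟩
    exact hu.map ((RingHom.fst S T).comp (fiberProduct πS πT).subtype)
  · rw [← hπS.2]
    exact hmem r hr
  · rw [← hπT.2]
    exact (show πS (r : S × T).1 = πT (r : S × T).2 from r.2).symm.trans (hmem r hr)

set_option synthInstance.maxHeartbeats 1000000 in
set_option maxHeartbeats 1000000 in
/-- Lemma: for a non-trivial fiber product `R = S ×_k T` of positive depth, there is a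
natural `R`-module isomorphism `(m_R·R̃ + R)/R ≅ ((m_S·S̃ + S)/S) ⊕ ((m_T·T̃ + T)/T)`;
in particular `(m_R·R̃ + R)/R` is cyclic iff `(m_S·S̃ + S)/S` and `(m_T·T̃ + T)/T` are
both cyclic and one of them is `0`. -/
theorem conductorTypeMod_fiberProduct
    (k S T : Type) [Field k] [CommRing S] [IsNoetherianRing S] [IsLocalRing S]
    [CommRing T] [IsNoetherianRing T] [IsLocalRing T]
    (πS : S →+* k) (πT : T →+* k)
    (hπS : IsResidueSurjection πS) (hπT : IsResidueSurjection πT)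
    (hSnt : IsLocalRing.maximalIdeal S ≠ ⊥) (hTnt : IsLocalRing.maximalIdeal T ≠ ⊥)
    (hdS : 1 ≤ moduleDepth S S) (hdT : 1 ≤ moduleDepth T T)
    [IsLocalRing ↥(fiberProduct πS πT)]
    (QR QS QT : Type) [CommRing QR] [CommRing QS] [CommRing QT]
    [Algebra ↥(fiberProduct πS πT) QR] [IsFractionRing ↥(fiberProduct πS πT) QR]
    [Algebra S QS] [IsFractionRing S QS]
    [Algebra T QT] [IsFractionRing T QT] :
    (∃ e : ↥(conductorTypeMod ↥(fiberProduct πS πT) QR) ≃+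
        (↥(conductorTypeMod S QS) × ↥(conductorTypeMod T QT)),
      ∀ (r : ↥(fiberProduct πS πT)) (x : ↥(conductorTypeMod ↥(fiberProduct πS πT) QR)),
        e (r • x) = ((r : S × T).1 • (e x).1, (r : S × T).2 • (e x).2)) ∧
    ((conductorTypeMod ↥(fiberProduct πS πT) QR).IsPrincipal ↔
      ((conductorTypeMod S QS).IsPrincipal ∧ (conductorTypeMod T QT).IsPrincipal ∧
        (conductorTypeMod S QS = ⊥ ∨ conductorTypeMod T QT = ⊥))) := by
  have h := isLocalFiberProduct_fiberProduct hπS hπT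
  obtain ⟨a, ha, ha'⟩ := exists_mem_nonZeroDivisors_of_one_le_moduleDepth S hdS
  obtain ⟨b, hb, hb'⟩ := exists_mem_nonZeroDivisors_of_one_le_moduleDepth T hdT
  obtain ⟨φ, hφ⟩ := h.exists_ringEquiv_prod ha ha' hb hb' QR QS QT
  obtain ⟨e, he⟩ := h.exists_addEquiv_conductorTypeMod
    (IsFractionRing.injective S QS) (IsFractionRing.injective T QT) hφ
  exact ⟨⟨e, he⟩, h.isPrincipal_iff e he⟩
end

section
/- Let (R, m_R) be a local ring whose maximal ideal m_R is decomposable. If R has finite Cohen-Macaulay type, then dim(R) ≥ 1. -/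
/-! Common definitions for formalizing Nasseh–Sather-Wagstaff–Takahashi–VandeBogert,
"Applications and homological properties of local rings with decomposable maximal ideals". -/

open CategoryTheory IsLocalRing

/-- `Ext⁰(M, N) = 0` forces `Hom(M, N) = 0`. -/
theorem linearMap_eq_zero_of_subsingleton_extGrp_zero {R : Type u} [CommRing R]
    {M N : Type u} [AddCommGroup M] [Module R M] [AddCommGroup N] [Module R N]
    (h : Subsingleton (extGrp R 0 M N)) (f : M →ₗ[R] N) : f = 0 := by
  let X := ModuleCat.of R M
  let Y := ModuleCat.of R N
  let F := ((linearYoneda R (ModuleCat.{u} R)).obj Y).rightOp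
  let P : ProjectiveResolution X := projectiveResolution X
  have h0 : Limits.IsZero ((F.leftDerived 0).obj X) :=
    (ModuleCat.isZero_of_subsingleton (extGrp R 0 M N)).op
  have h1 : F.map (P.π.f 0) = 0 := by
    rw [← ProjectiveResolution.pOpcycles_comp_fromLeftDerivedZero' P F]
    have h2 : Limits.IsZero (((F.mapHomologicalComplex _).obj P.complex).opcycles 0) :=
      (h0.of_iso (P.isoLeftDerivedObj F 0).symm).of_iso (ChainComplex.isoHomologyι₀ _).symm
    rw [h2.eq_of_src (P.fromLeftDerivedZero' F) 0, Limits.comp_zero]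
    rfl
  have h3 : P.π.f 0 ≫ ModuleCat.ofHom f = 0 := by
    have := congrArg (fun g => g.unop.hom (ModuleCat.ofHom f)) h1
    exact this
  have h4 : ModuleCat.ofHom f = 0 := by
    have : Epi (P.π.f 0) := inferInstance
    exact (cancel_epi (P.π.f 0)).1 (h3.trans Limits.comp_zero.symm)
  exact congrArg ModuleCat.Hom.hom h4

/-- Over a local ring of Krull dimension zero every nonzero finitely generated module is
maximal Cohen-Macaulay. -/
theorem isMCM_of_ringKrullDim_eq_zero {R : Type u} [CommRing R] [IsNoetherianRing R] [IsLocalRing R]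
    (hdim : ringKrullDim R = 0) (M : Type u) [AddCommGroup M] [Module R M]
    [Module.Finite R M] [Nontrivial M] : IsMCM R M := by
  refine ⟨inferInstance, ?_⟩
  have : Ring.KrullDimLE 0 R := by
    rw [Ring.krullDimLE_iff]; simp [hdim]
  obtain ⟨p, hp⟩ := associatedPrimes.nonempty R M
  have hprime := hp.isPrime
  have hpm : p = maximalIdeal R := IsLocalRing.eq_maximalIdeal inferInstance
  obtain ⟨-, f, hf⟩ := (isAssociatedPrime_iff_exists_injective_linearMap p M).1 hp
  subst hpm
  have hd : moduleDepth R M = 0 := by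
    refine le_antisymm (sInf_le ⟨0, rfl, fun hs => ?_⟩) bot_le
    have h0 := linearMap_eq_zero_of_subsingleton_extGrp_zero
      (M := ResidueField R) (N := M) hs f
    have h1 : (1 : ResidueField R) = 0 := hf (by
      exact (congrArg (fun g : ResidueField R →ₗ[R] M => g 1) h0).trans (map_zero f).symm)
    exact one_ne_zero h1
  rw [hd, hdim]; rfl

/-- A nonzero finitely generated module over a local ring has a functional to the residue field
taking the value `1`. -/
theorem exists_linearMap_residueField_eq_one {R M : Type*} [CommRing R] [IsLocalRing R]
    [AddCommGroup M] [Module R M] [Module.Finite R M] [Nontrivial M] :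
    ∃ (f : M →ₗ[R] ResidueField R) (x : M), f x = 1 := by
  obtain h | ⟨N, hN, -⟩ := eq_top_or_exists_le_coatom (⊥ : Submodule R M)
  · exact absurd h bot_ne_top
  obtain ⟨I, hI, ⟨e⟩⟩ := isSimpleModule_iff_quot_maximal.1 (isSimpleModule_iff_isCoatom.2 hN)
  obtain rfl := IsLocalRing.eq_maximalIdeal hI
  obtain ⟨x, hx⟩ := (e.surjective.comp N.mkQ_surjective) (1 : R ⧸ maximalIdeal R)
  exact ⟨e.toLinearMap ∘ₗ N.mkQ, x, hx⟩

/-- If the maximal ideal is decomposable, its generators `x, y` from the two summands have dual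
functionals to the residue field. -/
theorem HasDecomposableMaxIdeal.exists_dual_pair {R : Type u} [CommRing R] [IsNoetherianRing R]
    [IsLocalRing R] (h : HasDecomposableMaxIdeal R) :
    ∃ (a b : maximalIdeal R →ₗ[R] ResidueField R) (x y : maximalIdeal R),
      a x = 1 ∧ a y = 0 ∧ b x = 0 ∧ b y = 1 := by
  obtain ⟨I, J, hI, hJ, hinf, hsup⟩ := h
  have hIm : I ≤ maximalIdeal R := hsup ▸ le_sup_left
  have hJm : J ≤ maximalIdeal R := hsup ▸ le_sup_right
  have : Nontrivial I := Submodule.nontrivial_iff_ne_bot.2 hI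
  have : Nontrivial J := Submodule.nontrivial_iff_ne_bot.2 hJ
  obtain ⟨f, x, hx⟩ := exists_linearMap_residueField_eq_one (R := R) (M := I)
  obtain ⟨g, y, hy⟩ := exists_linearMap_residueField_eq_one (R := R) (M := J)
  let φ : (I × J) →ₗ[R] maximalIdeal R :=
    (Submodule.inclusion hIm).coprod (Submodule.inclusion hJm)
  have hφ : Function.Bijective φ := by
    constructor
    · rw [← LinearMap.ker_eq_bot, LinearMap.ker_eq_bot']
      rintro ⟨u, v⟩ huv
      have huv' : (u : R) + v = 0 := congrArg Subtype.val huv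
      have hu : (u : R) ∈ I ⊓ J := ⟨u.2, by
        rw [eq_neg_of_add_eq_zero_left huv']; exact J.neg_mem v.2⟩
      rw [hinf, Submodule.mem_bot] at hu
      rw [hu, zero_add] at huv'
      exact Prod.ext (Subtype.ext hu) (Subtype.ext huv')
    · rintro ⟨z, hz⟩
      rw [← hsup] at hz
      obtain ⟨u, hu, v, hv, rfl⟩ := Submodule.mem_sup.1 hz
      exact ⟨(⟨u, hu⟩, ⟨v, hv⟩), rfl⟩
  let E := LinearEquiv.ofBijective φ hφ
  have hEx : E.symm (φ (x, 0)) = (x, 0) := E.symm_apply_apply _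
  have hEy : E.symm (φ (0, y)) = (0, y) := E.symm_apply_apply _
  refine ⟨f ∘ₗ LinearMap.fst R I J ∘ₗ E.symm, g ∘ₗ LinearMap.snd R I J ∘ₗ E.symm,
    φ (x, 0), φ (0, y), ?_, ?_, ?_, ?_⟩ <;> simp [hEx, hEy, hx, hy]

section Zigzag

open Polynomial

variable {R : Type u} [CommRing R] [IsLocalRing R]

/-- The map `(wᵢ) ↦ ∑ (a wᵢ + b wᵢ X) Xⁱ` on vectors with entries in the maximal ideal. -/
noncomputable def zigzagMap (a b : maximalIdeal R →ₗ[R] ResidueField R) (n : ℕ) :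
    (Fin n → maximalIdeal R) →ₗ[R] (ResidueField R)[X] :=
  ∑ i : Fin n, ((monomial (i : ℕ)).restrictScalars R ∘ₗ a +
    (monomial ((i : ℕ) + 1)).restrictScalars R ∘ₗ b) ∘ₗ LinearMap.proj i

/-- The relations of the zigzag module. -/
noncomputable def zigzagRelations (a b : maximalIdeal R →ₗ[R] ResidueField R) (n : ℕ) :
    Submodule R (Fin n → R) :=
  (LinearMap.ker (zigzagMap a b n)).map ((maximalIdeal R).subtype.compLeft (Fin n))

/-- The zigzag module on `n` generators `eᵢ`. If `x, y` is dual to `a, b`, it satisfies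
`x • eᵢ₊₁ = y • eᵢ`. -/
abbrev ZigzagModule (a b : maximalIdeal R →ₗ[R] ResidueField R) (n : ℕ) : Type u :=
  (Fin n → R) ⧸ zigzagRelations a b n

/-- The reduction of a vector, as a polynomial over the residue field. -/
noncomputable def residuePoly {n : ℕ} (v : Fin n → R) : (ResidueField R)[X] :=
  ∑ i : Fin n, monomial (i : ℕ) (residue R (v i))

theorem coeff_residuePoly {n : ℕ} (v : Fin n → R) (j : Fin n) :
    (residuePoly v).coeff j = residue R (v j) := by
  simp [residuePoly, coeff_monomial, Fin.val_inj]

theorem residuePoly_single {n : ℕ} (i : Fin n) :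
    residuePoly (Pi.single i (1 : R)) = X ^ (i : ℕ) := by
  rw [residuePoly, Finset.sum_eq_single i]
  · simp [X_pow_eq_monomial]
  · intro j _ hj; simp [Pi.single_eq_of_ne hj]
  · simp

theorem degree_residuePoly_lt {n : ℕ} (v : Fin n → R) : (residuePoly v).degree < n := by
  rw [← mem_degreeLT]
  exact Submodule.sum_mem _ fun i _ => mem_degreeLT.2 <|
    (degree_monomial_le _ _).trans_lt (by exact_mod_cast i.2)

variable (a b : maximalIdeal R →ₗ[R] ResidueField R)

theorem zigzagMap_smul_of_left {x : maximalIdeal R} (hax : a x = 1) (hbx : b x = 0) {n : ℕ}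
    (v : Fin n → R) : zigzagMap a b n (fun i => v i • x) = residuePoly v := by
  simp [zigzagMap, residuePoly, hax, hbx, Algebra.smul_def]

theorem zigzagMap_smul_of_right {y : maximalIdeal R} (hay : a y = 0) (hby : b y = 1) {n : ℕ}
    (v : Fin n → R) : zigzagMap a b n (fun i => v i • y) = X * residuePoly v := by
  simp [zigzagMap, residuePoly, hay, hby, Algebra.smul_def, Finset.mul_sum, X_mul_monomial]

theorem coe_mem_zigzagRelations {n : ℕ} {w : Fin n → maximalIdeal R} :
    (fun i => (w i : R)) ∈ zigzagRelations a b n ↔ zigzagMap a b n w = 0 := by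
  constructor
  · rintro ⟨w', hw', h⟩
    obtain rfl : w' = w := funext fun i => Subtype.ext (congrFun h i)
    exact hw'
  · exact fun h => ⟨w, h, rfl⟩

theorem mem_maximalIdeal_of_mem_zigzagRelations {n : ℕ} {v : Fin n → R}
    (hv : v ∈ zigzagRelations a b n) (i : Fin n) : v i ∈ maximalIdeal R := by
  obtain ⟨w, -, rfl⟩ := hv
  exact (w i).2

theorem smul_sub_smul_mem_zigzagRelations {x y : maximalIdeal R} (hax : a x = 1) (hay : a y = 0)
    (hbx : b x = 0) (hby : b y = 1) {n : ℕ} (v w : Fin n → R) :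
    (x : R) • v - (y : R) • w ∈ zigzagRelations a b n ↔
      residuePoly v = X * residuePoly w := by
  have h : (x : R) • v - (y : R) • w =
      fun i => (((fun i => v i • x) - fun i => w i • y : Fin n → maximalIdeal R) i : R) := by
    ext i; simp [mul_comm]
  rw [h, coe_mem_zigzagRelations, map_sub, zigzagMap_smul_of_left a b hax hbx,
    zigzagMap_smul_of_right a b hay hby, sub_eq_zero]

/-- Modulo the maximal ideal, every endomorphism of the zigzag module is a scalar. -/
theorem exists_sub_smul_mem_of_end {x y : maximalIdeal R} (hax : a x = 1) (hay : a y = 0)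
    (hbx : b x = 0) (hby : b y = 1) {n : ℕ} (e : Module.End R (ZigzagModule a b (n + 1))) :
    ∃ c : R, ∀ z, e z - c • z ∈ maximalIdeal R • (⊤ : Submodule R (ZigzagModule a b (n + 1))) := by
  let K := zigzagRelations a b (n + 1)
  let g : Fin (n + 1) → Fin (n + 1) → R := fun i => Pi.single i 1
  choose v hv using fun i => K.mkQ_surjective (e (K.mkQ (g i)))
  have hsucc (i : Fin n) : residuePoly (v i.succ) = X * residuePoly (v i.castSucc) := by
    rw [← smul_sub_smul_mem_zigzagRelations a b hax hay hbx hby]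
    have h0 : (x : R) • g i.succ - (y : R) • g i.castSucc ∈ K := by
      rw [smul_sub_smul_mem_zigzagRelations a b hax hay hbx hby, residuePoly_single,
        residuePoly_single, Fin.val_succ, Fin.val_castSucc, pow_succ']
    change _ ∈ K
    rw [← Submodule.ker_mkQ K, LinearMap.mem_ker] at h0 ⊢
    have h1 := congrArg e h0
    simp only [map_sub, map_smul, map_zero] at h1 ⊢
    rw [hv, hv]
    exact h1
  have hpow (i : Fin (n + 1)) : residuePoly (v i) = X ^ (i : ℕ) * residuePoly (v 0) := by
    induction i using Fin.induction with
    | zero => simp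
    | succ i ih => rw [hsucc, ih, Fin.val_succ, pow_succ', mul_assoc, Fin.val_castSucc]
  have hconst : residuePoly (v 0) = C (residue R (v 0 0)) := by
    have hdeg := degree_residuePoly_lt (v (Fin.last n))
    rw [hpow, Fin.val_last, mul_comm, degree_mul_X_pow] at hdeg
    have h0 : (residuePoly (v 0)).degree ≤ 0 := by
      by_contra! h1
      rw [degree_eq_natDegree (by rintro h2; simp [h2] at h1)] at h1 hdeg
      norm_cast at h1 hdeg
      omega
    rw [eq_C_of_degree_le_zero h0]
    congr 1
    exact coeff_residuePoly (v 0) 0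
  refine ⟨v 0 0, ?_⟩
  let c := v 0 0
  let T := maximalIdeal R • (⊤ : Submodule R (ZigzagModule a b (n + 1)))
  have hT (w : Fin (n + 1) → R) (hw : ∀ j, w j ∈ maximalIdeal R) : K.mkQ w ∈ T := by
    rw [pi_eq_sum_univ' w, map_sum]
    refine Submodule.sum_mem _ fun j _ => ?_
    rw [map_smul]
    exact Submodule.smul_mem_smul (hw j) trivial
  have hzero : T.mkQ ∘ₗ (e - c • LinearMap.id) ∘ₗ K.mkQ = 0 := by
    refine LinearMap.pi_ext' fun i => LinearMap.ext_ring ?_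
    have h1 : K.mkQ (v i - c • g i) ∈ T := by
      refine hT _ fun j => ?_
      rw [← residue_eq_zero_iff, Pi.sub_apply, Pi.smul_apply, map_sub, ← coeff_residuePoly, hpow,
        hconst, mul_comm, coeff_C_mul, coeff_X_pow]
      by_cases hij : j = i
      · simp [hij, g, c]
      · simp [hij, g, Fin.val_inj]
    rw [map_sub, hv, map_smul] at h1
    exact (Submodule.Quotient.mk_eq_zero T).2 h1
  intro z
  obtain ⟨w, rfl⟩ := K.mkQ_surjective z
  have := LinearMap.congr_fun hzero w
  rw [LinearMap.zero_apply] at this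
  exact (Submodule.Quotient.mk_eq_zero T).1 this

instance nontrivial_zigzagModule (n : ℕ) : Nontrivial (ZigzagModule a b (n + 1)) := by
  refine Submodule.Quotient.nontrivial_iff.2 fun h => ?_
  have h1 : (fun _ => 1 : Fin (n + 1) → R) ∈ zigzagRelations a b (n + 1) := h ▸ trivial
  exact (Ideal.ne_top_iff_one _).1 (maximalIdeal.isMaximal R).ne_top
    (mem_maximalIdeal_of_mem_zigzagRelations a b h1 0)

/-- A module over a local ring whose endomorphisms are scalars modulo the maximal ideal is
indecomposable. -/
theorem isIndecomposableMod_of_end {M : Type u} [AddCommGroup M] [Module R M]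
    [IsNoetherian R M] [Nontrivial M]
    (h : ∀ e : Module.End R M, ∃ c : R, ∀ z, e z - c • z ∈ maximalIdeal R • (⊤ : Submodule R M)) :
    IsIndecomposableMod R M := by
  refine ⟨not_subsingleton M, fun A B hAB => ?_⟩
  have key (A B : Submodule R M) (hAB : IsCompl A B)
      (hle : A ≤ maximalIdeal R • (⊤ : Submodule R M)) : A = ⊥ := by
    refine Submodule.eq_bot_of_le_smul_of_le_jacobson_bot (maximalIdeal R) A
      (IsNoetherian.noetherian A) ?_ (IsLocalRing.jacobson_eq_maximalIdeal ⊥ bot_ne_top).ge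
    have h1 := Submodule.map_mono (f := (A.projection B hAB)) hle
    rw [Submodule.map_smul'', Submodule.map_top, Submodule.range_projection] at h1
    refine le_trans (fun z hz => ?_) h1
    exact ⟨z, hz, Submodule.projection_apply_left hAB ⟨z, hz⟩⟩
  obtain ⟨c, hc⟩ := h (A.projection B hAB)
  by_cases hcm : c ∈ maximalIdeal R
  · refine Or.inl (key A B hAB fun z hz => ?_)
    have h1 := hc z
    rw [show A.projection B hAB z = z from Submodule.projection_apply_left hAB ⟨z, hz⟩] at h1
    simpa using Submodule.add_mem _ h1 (Submodule.smul_mem_smul hcm (Submodule.mem_top (x := z)))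
  · refine Or.inr (key B A hAB.symm fun z hz => ?_)
    have h1 := hc z
    rw [(Submodule.projection_apply_eq_zero_iff hAB).2 hz, zero_sub,
      Submodule.neg_mem_iff] at h1
    exact (Submodule.smul_mem_iff_of_isUnit _ (by simpa using hcm)).1 h1

theorem le_of_surjective_zigzagModule {m n : ℕ}
    (f : ZigzagModule a b m →ₗ[R] ZigzagModule a b n) (hf : Function.Surjective f) : n ≤ m := by
  let ρ : (Fin n → R) →ₗ[R] (Fin n → ResidueField R) :=
    (Algebra.linearMap R (ResidueField R)).compLeft (Fin n)
  have hρ : Function.Surjective ρ := fun w => by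
    choose v hv using fun i => residue_surjective (w i)
    exact ⟨v, funext hv⟩
  let q : ZigzagModule a b n →ₗ[R] (Fin n → ResidueField R) :=
    (zigzagRelations a b n).liftQ ρ fun v hv => by
      ext i
      exact (residue_eq_zero_iff _).2 (mem_maximalIdeal_of_mem_zigzagRelations a b hv i)
  have hq : Function.Surjective q := fun w => by
    obtain ⟨v, rfl⟩ := hρ w
    exact ⟨Submodule.Quotient.mk v, rfl⟩
  let F : (Fin m → R) →ₗ[R] (Fin n → ResidueField R) := q ∘ₗ f ∘ₗ (zigzagRelations a b m).mkQ
  have hF : Function.Surjective F := hq.comp (hf.comp (Submodule.mkQ_surjective _))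
  have hspan : Submodule.span (ResidueField R) (Set.range fun i => F (Pi.single i 1)) = ⊤ := by
    rw [eq_top_iff]
    intro w _
    obtain ⟨v, rfl⟩ := hF w
    rw [pi_eq_sum_univ' v, map_sum]
    refine Submodule.sum_mem _ fun i _ => ?_
    rw [map_smul, ← algebraMap_smul (ResidueField R)]
    exact Submodule.smul_mem _ _ (Submodule.subset_span ⟨i, rfl⟩)
  have := finrank_range_le_card (R := ResidueField R) fun i => F (Pi.single i 1)
  rw [Set.finrank, hspan, finrank_top] at this
  simpa using this

end Zigzag

/-- Lemma: a local ring with decomposable maximal ideal and finite Cohen-Macaulay type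
has Krull dimension at least 1. -/
theorem one_le_krullDim_of_decomposable_of_finiteCMType
    (R : Type) [CommRing R] [IsNoetherianRing R] [IsLocalRing R]
    (hdec : HasDecomposableMaxIdeal R) (hfin : HasFiniteCMType R) :
    (1 : WithBot ℕ∞) ≤ ringKrullDim R := by
  by_contra hlt
  have hdim : ringKrullDim R = 0 :=
    le_antisymm (Order.le_of_lt_succ (not_le.1 hlt)) ringKrullDim_nonneg_of_nontrivial
  obtain ⟨a, b, x, y, hax, hay, hbx, hby⟩ := hdec.exists_dual_pair
  obtain ⟨L, hL⟩ := hfin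
  let M (n : ℕ) : ModuleCat.{0} R := ModuleCat.of R (ZigzagModule a b (n + 1))
  have hM (n : ℕ) : ∃ N : {N // N ∈ L}, Nonempty (M n ≅ N.1) := by
    obtain ⟨N, hN, h⟩ := hL (M n) (isMCM_of_ringKrullDim_eq_zero hdim _)
      (isIndecomposableMod_of_end (exists_sub_smul_mem_of_end a b hax hay hbx hby))
    exact ⟨⟨N, hN⟩, h⟩
  choose N hN using hM
  have : Finite {N // N ∈ L} := List.finite_toSet L
  obtain ⟨m, n, hmn, h⟩ := Finite.exists_ne_map_eq_of_infinite N
  obtain ⟨i⟩ := hN m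
  obtain ⟨j⟩ := hN n
  let e : ZigzagModule a b (m + 1) ≃ₗ[R] ZigzagModule a b (n + 1) :=
    (i ≪≫ eqToIso (congrArg Subtype.val h) ≪≫ j.symm).toLinearEquiv
  have h1 := le_of_surjective_zigzagModule a b e.toLinearMap e.surjective
  have h2 := le_of_surjective_zigzagModule a b e.symm.toLinearMap e.symm.surjective
  omega
end

section
/- Let R ≅ S ×_k T be a non-trivial fiber product of local rings (S, m_S, k) and (T, m_T, k), and let M be a finitely generated S-module, regarded as the R-module M ⊕ 0 via the surjection R → S. Then M ⊕ 0 is maximal Cohen-Macaulay over R if and only if M is maximal Cohen-Macaulay over S and dim(S) ≥ dim(T). -/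
/-! Common definitions for formalizing Nasseh–Sather-Wagstaff–Takahashi–VandeBogert,
"Applications and homological properties of local rings with decomposable maximal ideals". -/

open CategoryTheory IsLocalRing

/-- The canonical surjection `S ×_k T → S`. -/
def fpToS {k S T : Type} [CommRing S] [CommRing T] [CommRing k]
    (πS : S →+* k) (πT : T →+* k) : ↥(fiberProduct πS πT) →+* S :=
  (RingHom.fst S T).comp (fiberProduct πS πT).subtype

/-- Indecomposability of `M` as an `A`-module via restriction of scalars along `f`. -/
def IsIndecomposableVia {A B : Type} [CommRing A] [CommRing B] (f : A →+* B)
    (M : Type) [AddCommGroup M] [Module B M] : Prop :=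
  letI : Module A M := Module.compHom M f
  IsIndecomposableMod A M

/-- The depth of `M` as an `A`-module via restriction of scalars along `f`. -/
noncomputable def moduleDepthVia {A B : Type} [CommRing A] [IsLocalRing A] [CommRing B]
    (f : A →+* B) (M : Type) [AddCommGroup M] [Module B M] : ℕ∞ :=
  letI : Module A M := Module.compHom M f
  moduleDepth A M

/-- `M` is maximal Cohen-Macaulay as an `A`-module via restriction of scalars along `f`. -/
def IsMCMVia {A B : Type} [CommRing A] [IsLocalRing A] [CommRing B]
    (f : A →+* B) (M : Type) [AddCommGroup M] [Module B M] : Prop :=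
  letI : Module A M := Module.compHom M f
  IsMCM A M

/-- `M` and `M'` are isomorphic as `A`-modules via restriction of scalars along `f`. -/
def LinearIsoVia {A B : Type} [CommRing A] [CommRing B] (f : A →+* B)
    (M M' : Type) [AddCommGroup M] [Module B M] [AddCommGroup M'] [Module B M'] : Prop :=
  letI : Module A M := Module.compHom M f
  letI : Module A M' := Module.compHom M' f
  Nonempty (M ≃ₗ[A] M')

universe u

namespace CategoryTheory.ProjectiveResolution

open Limits

variable {C : Type*} [Category* C] [Abelian C] [HasExt C] {X : C}

theorem subsingleton_abelianExt_succ_iff (P : ProjectiveResolution X) (Y : C) (n : ℕ) :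
    Subsingleton (Abelian.Ext X Y (n + 1)) ↔
      ∀ f : P.complex.X (n + 1) ⟶ Y, P.complex.d (n + 2) (n + 1) ≫ f = 0 →
        ∃ g : P.complex.X n ⟶ Y, P.complex.d (n + 1) n ≫ g = f := by
  refine ⟨fun _ f hf ↦ ?_, fun h ↦ ?_⟩
  · exact (P.extMk_eq_zero_iff f (n + 2) rfl hf n rfl).mp (Subsingleton.elim _ _)
  · refine subsingleton_of_forall_eq 0 fun α ↦ ?_
    obtain ⟨f, hf, rfl⟩ := P.extMk_surjective α (n + 2) rfl
    exact (P.extMk_eq_zero_iff f (n + 2) rfl hf n rfl).mpr (h f hf)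

theorem subsingleton_abelianExt_zero_iff (P : ProjectiveResolution X) (Y : C) :
    Subsingleton (Abelian.Ext X Y 0) ↔
      ∀ f : P.complex.X 0 ⟶ Y, P.complex.d 1 0 ≫ f = 0 → f = 0 := by
  rw [Abelian.Ext.addEquiv₀.subsingleton_congr]
  change Subsingleton (P.cokernelCofork.pt ⟶ Y) ↔ _
  refine ⟨fun _ f hf ↦ ?_, fun h ↦ ?_⟩
  · obtain ⟨g, rfl⟩ := CokernelCofork.IsColimit.desc' P.isColimitCokernelCofork f hf
    rw [Subsingleton.elim g 0, comp_zero]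
  · refine subsingleton_of_forall_eq 0 fun g ↦ ?_
    refine Cofork.IsColimit.hom_ext P.isColimitCokernelCofork ?_
    refine (h (P.cokernelCofork.π ≫ g) ?_).trans comp_zero.symm
    rw [← Category.assoc, P.cokernelCofork.condition, zero_comp]

end CategoryTheory.ProjectiveResolution

theorem subsingleton_extGrp_iff (R : Type u) [CommRing R] (i : ℕ)
    (M N : Type u) [AddCommGroup M] [Module R M] [AddCommGroup N] [Module R N] :
    Subsingleton (extGrp R i M N) ↔
      Subsingleton (Abelian.Ext (ModuleCat.of R M) (ModuleCat.of R N) i) := by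
  let P := ProjectiveResolution.of (ModuleCat.of R M)
  rw [extGrp, ← ModuleCat.isZero_iff_subsingleton,
    (P.isoExt i (ModuleCat.of R N)).isZero_iff, ← HomologicalComplex.exactAt_iff_isZero_homology]
  cases i with
  | zero =>
    rw [P.subsingleton_abelianExt_zero_iff, HomologicalComplex.exactAt_iff' _ 0 0 1
      (by simp) (by simp), ShortComplex.moduleCat_exact_iff]
    have h0 : ((P.complex.linearYonedaObj R (ModuleCat.of R N)).sc' 0 0 1).f = 0 :=
      (P.complex.linearYonedaObj R (ModuleCat.of R N)).shape 0 0 (Nat.succ_ne_zero 0)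
    refine forall₂_congr fun f _ ↦ ⟨fun ⟨g, hg⟩ ↦ ?_, fun h ↦ ⟨0, by rw [h0]; exact h.symm⟩⟩
    rw [h0] at hg
    exact hg.symm
  | succ n =>
    rw [P.subsingleton_abelianExt_succ_iff, HomologicalComplex.exactAt_iff' _ n (n + 1) (n + 2)
      (by simp) (by simp), ShortComplex.moduleCat_exact_iff]
    exact Iff.rfl

theorem natCast_le_moduleDepth_iff {R : Type u} [CommRing R] [IsLocalRing R]
    {M : Type u} [AddCommGroup M] [Module R M] {n : ℕ} :
    (n : ℕ∞) ≤ moduleDepth R M ↔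
      ∀ i < n, Subsingleton (extGrp R i (ResidueField R) M) := by
  rw [moduleDepth, le_sInf_iff]
  refine ⟨fun h i hi ↦ ?_, ?_⟩
  · by_contra hc
    exact absurd (h _ ⟨i, rfl, hc⟩) (by simpa using hi)
  · rintro h _ ⟨i, rfl, hi⟩
    by_contra! hc
    exact hi (h i (by simpa using hc))

theorem moduleDepth_eq_top_of_subsingleton (R : Type u) [CommRing R] [IsLocalRing R]
    (M : Type u) [AddCommGroup M] [Module R M] [Subsingleton M] : moduleDepth R M = ⊤ := by
  refine ENat.eq_top_iff_forall_ge.mpr fun n ↦ natCast_le_moduleDepth_iff.mpr fun i _ ↦ ?_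
  rw [subsingleton_extGrp_iff]
  have : 𝟙 (ModuleCat.of R M) = 0 := by ext; exact Subsingleton.elim _ _
  refine subsingleton_of_forall_eq 0 fun x ↦ ?_
  rw [← x.comp_mk₀_id, this, Abelian.Ext.mk₀_zero, Abelian.Ext.comp_zero]

theorem natCast_le_moduleDepth_iff_exists_isRegular {R : Type u} [CommRing R] [IsNoetherianRing R]
    [IsLocalRing R] {M : Type u} [AddCommGroup M] [Module R M] [Module.Finite R M] [Nontrivial M]
    {n : ℕ} :
    (n : ℕ∞) ≤ moduleDepth R M ↔
      ∃ rs : List R, rs.length = n ∧ (∀ r ∈ rs, r ∈ maximalIdeal R) ∧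
        RingTheory.Sequence.IsRegular M rs := by
  have smul_lt : maximalIdeal R • (⊤ : Submodule R (ModuleCat.of R M)) < ⊤ :=
    (Submodule.top_ne_ideal_smul_of_le_jacobson_annihilator
      (IsLocalRing.maximalIdeal_le_jacobson _)).symm.lt_top
  have supp : Module.support R (ModuleCat.of R (ResidueField R)) =
      PrimeSpectrum.zeroLocus (maximalIdeal R : Set R) := by
    rw [Module.support_eq_zeroLocus]
    exact congrArg (fun I : Ideal R ↦ PrimeSpectrum.zeroLocus (I : Set R))
      Ideal.annihilator_quotient
  have tfae := ModuleCat.exists_isRegular_tfae (maximalIdeal R) n (ModuleCat.of R M) smul_lt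
  simp only [natCast_le_moduleDepth_iff, subsingleton_extGrp_iff]
  have h23 := tfae.out 2 3
  have h30 := tfae.out 3 0
  refine ⟨fun h ↦ h23.mp
    ⟨_, inferInstanceAs (Nontrivial (ResidueField R)),
      inferInstanceAs (Module.Finite R (ResidueField R)), supp, h⟩,
    fun h ↦ h30.mp h _ (inferInstanceAs (Nontrivial (ResidueField R)))
      (inferInstanceAs (Module.Finite R (ResidueField R))) supp.subset⟩

theorem moduleDepth_le_ringKrullDim (R : Type u) [CommRing R] [IsNoetherianRing R]
    [IsLocalRing R] (M : Type u) [AddCommGroup M] [Module R M] [Module.Finite R M]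
    [Nontrivial M] : (moduleDepth R M : WithBot ℕ∞) ≤ ringKrullDim R := by
  obtain ⟨d, hd⟩ := WithBot.ne_bot_iff_exists.mp (ringKrullDim_ne_bot (R := R))
  rw [← hd, WithBot.coe_le_coe]
  refine ENat.forall_natCast_le_iff_le.mp fun n hn ↦ ?_
  obtain ⟨rs, rfl, -, reg⟩ := natCast_le_moduleDepth_iff_exists_isRegular.mp hn
  have : Nontrivial (M ⧸ Ideal.ofList rs • (⊤ : Submodule R M)) :=
    Submodule.Quotient.nontrivial_iff.mpr reg.2.symm
  rw [← WithBot.coe_le_coe, hd]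
  refine le_trans ?_ (Module.supportDim_le_ringKrullDim R M)
  rw [← Module.supportDim_add_length_eq_supportDim_of_isRegular rs reg]
  obtain ⟨e, he⟩ := WithBot.ne_bot_iff_exists.mp (Module.supportDim_ne_bot_of_nontrivial R
    (M ⧸ Ideal.ofList rs • (⊤ : Submodule R M)))
  rw [← he]
  exact WithBot.coe_le_coe.mpr le_add_self

theorem isRegular_map_algebraMap_iff {R S M : Type*} [CommRing R] [CommRing S] [Algebra R S]
    [AddCommGroup M] [Module R M] [Module S M] [IsScalarTower R S M] (rs : List R) :
    RingTheory.Sequence.IsRegular M (rs.map (algebraMap R S)) ↔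
      RingTheory.Sequence.IsRegular M rs :=
  (AddEquiv.refl M).isRegular_congr <| List.forall₂_map_left_iff.mpr <|
    List.forall₂_same.mpr fun r _ ↦ algebraMap_smul S r

theorem moduleDepth_eq_of_surjective_algebraMap {R S : Type u} [CommRing R] [IsNoetherianRing R]
    [IsLocalRing R] [CommRing S] [IsNoetherianRing S] [IsLocalRing S] [Algebra R S]
    (hRS : Function.Surjective (algebraMap R S))
    (M : Type u) [AddCommGroup M] [Module R M] [Module S M] [IsScalarTower R S M]
    [Module.Finite S M] : moduleDepth R M = moduleDepth S M := by
  cases subsingleton_or_nontrivial M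
  · rw [moduleDepth_eq_top_of_subsingleton, moduleDepth_eq_top_of_subsingleton]
  have : Module.Finite R S := Module.Finite.of_surjective (Algebra.linearMap R S) hRS
  have : Module.Finite R M := Module.Finite.trans S M
  have : IsLocalHom (algebraMap R S) := hRS.isLocalHom
  refine ENat.eq_of_forall_natCast_le_iff fun n ↦ ?_
  rw [natCast_le_moduleDepth_iff_exists_isRegular, natCast_le_moduleDepth_iff_exists_isRegular]
  constructor
  · rintro ⟨rs, hlen, hmem, reg⟩
    refine ⟨rs.map (algebraMap R S), by simpa, ?_, (isRegular_map_algebraMap_iff rs).mpr reg⟩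
    simpa using hmem
  · rintro ⟨ss, hlen, hmem, reg⟩
    obtain ⟨rs, rfl⟩ := List.map_surjective_iff.mpr hRS ss
    refine ⟨rs, by simpa using hlen, ?_, (isRegular_map_algebraMap_iff rs).mp reg⟩
    simpa using hmem

theorem length_le_ringKrullDim_of_ker_le_head {R S : Type*} [CommRing R] [CommRing S]
    {f : R →+* S} (hf : Function.Surjective f) {q : LTSeries (PrimeSpectrum R)}
    (h : RingHom.ker f ≤ q.head.asIdeal) : (q.length : WithBot ℕ∞) ≤ ringKrullDim S := by
  rw [← ringKrullDim_eq_of_ringEquiv (RingHom.quotientKerEquivOfSurjective hf),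
    ringKrullDim_quotient]
  let q' : LTSeries (PrimeSpectrum.zeroLocus (RingHom.ker f : Set R)) :=
    ⟨q.length, fun i ↦ ⟨q i, h.trans (LTSeries.head_le q i)⟩, q.step⟩
  exact le_iSup (fun p : LTSeries _ ↦ (p.length : WithBot ℕ∞)) q'

theorem ringKrullDim_eq_max_of_surjective {R S T : Type*} [CommRing R] [CommRing S] [CommRing T]
    {f : R →+* S} {g : R →+* T} (hf : Function.Surjective f) (hg : Function.Surjective g)
    (hfg : RingHom.ker f ⊓ RingHom.ker g = ⊥) :
    ringKrullDim R = max (ringKrullDim S) (ringKrullDim T) := by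
  refine le_antisymm (iSup_le fun q ↦ ?_) (max_le (ringKrullDim_le_of_surjective f hf)
    (ringKrullDim_le_of_surjective g hg))
  rcases q.head.isPrime.inf_le.mp (hfg.trans_le bot_le) with h | h
  · exact le_max_of_le_left (length_le_ringKrullDim_of_ker_le_head hf h)
  · exact le_max_of_le_right (length_le_ringKrullDim_of_ker_le_head hg h)

theorem isNoetherianRing_of_surjective_of_ker_inf_ker {R S T : Type*} [CommRing R] [CommRing S]
    [CommRing T] [IsNoetherianRing S] [IsNoetherianRing T]
    {f : R →+* S} {g : R →+* T} (hf : Function.Surjective f) (hg : Function.Surjective g)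
    (hfg : RingHom.ker f ⊓ RingHom.ker g = ⊥) : IsNoetherianRing R := by
  let _ := Module.compHom S f
  let _ := Module.compHom T g
  have : RingHomSurjective f := ⟨hf⟩
  have : RingHomSurjective g := ⟨hg⟩
  let eS : S →ₛₗ[f] S := { AddMonoidHom.id S with map_smul' := fun _ _ ↦ rfl }
  let eT : T →ₛₗ[g] T := { AddMonoidHom.id T with map_smul' := fun _ _ ↦ rfl }
  have : IsNoetherian R S :=
    (eS.isNoetherian_iff_of_bijective Function.bijective_id).mpr inferInstance
  have : IsNoetherian R T :=
    (eT.isNoetherian_iff_of_bijective Function.bijective_id).mpr inferInstance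
  let φ : R →ₗ[R] S × T := { (f.prod g).toAddMonoidHom with map_smul' := (f.prod g).map_mul }
  refine isNoetherian_of_injective φ ((injective_iff_map_eq_zero φ).mpr fun r hr ↦ ?_)
  have : r ∈ RingHom.ker f ⊓ RingHom.ker g := ⟨congrArg Prod.fst hr, congrArg Prod.snd hr⟩
  simpa [hfg] using this

section FiberProduct

variable {k S T : Type} [CommRing k] [CommRing S] [CommRing T]

/-- The canonical surjection `S ×_k T → T`. -/
def fpToT (πS : S →+* k) (πT : T →+* k) : ↥(fiberProduct πS πT) →+* T :=
  (RingHom.snd S T).comp (fiberProduct πS πT).subtype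

variable {πS : S →+* k} {πT : T →+* k}

theorem fpToS_surjective (hπT : Function.Surjective πT) :
    Function.Surjective (fpToS πS πT) := fun s ↦
  let ⟨t, ht⟩ := hπT (πS s)
  ⟨⟨(s, t), ht.symm⟩, rfl⟩

theorem fpToT_surjective (hπS : Function.Surjective πS) :
    Function.Surjective (fpToT πS πT) := fun t ↦
  let ⟨s, hs⟩ := hπS (πT t)
  ⟨⟨(s, t), hs⟩, rfl⟩

theorem ker_fpToS_inf_ker_fpToT :
    RingHom.ker (fpToS πS πT) ⊓ RingHom.ker (fpToT πS πT) = ⊥ :=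
  eq_bot_iff.mpr fun _ ⟨hS, hT⟩ ↦ Subtype.ext (Prod.ext hS hT)

end FiberProduct

/-- Lemma: `M ⊕ 0` is maximal Cohen-Macaulay over `R = S ×_k T` iff `M` is maximal
Cohen-Macaulay over `S` and `dim S ≥ dim T`. -/
theorem mcm_restrict_fiberProduct
    (k S T : Type) [Field k] [CommRing S] [IsNoetherianRing S] [IsLocalRing S]
    [CommRing T] [IsNoetherianRing T] [IsLocalRing T]
    (πS : S →+* k) (πT : T →+* k)
    (hπS : IsResidueSurjection πS) (hπT : IsResidueSurjection πT)
    (hSnt : IsLocalRing.maximalIdeal S ≠ ⊥) (hTnt : IsLocalRing.maximalIdeal T ≠ ⊥)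
    [IsLocalRing ↥(fiberProduct πS πT)]
    (M : Type) [AddCommGroup M] [Module S M] (hM : Module.Finite S M) :
    IsMCMVia (fpToS πS πT) M ↔ (IsMCM S M ∧ ringKrullDim T ≤ ringKrullDim S) := by
  have hfS := fpToS_surjective (πS := πS) hπT.1
  have hfT := fpToT_surjective (πT := πT) hπS.1
  have : IsNoetherianRing (fiberProduct πS πT) :=
    isNoetherianRing_of_surjective_of_ker_inf_ker hfS hfT ker_fpToS_inf_ker_fpToT
  let _ : Algebra (fiberProduct πS πT) S := (fpToS πS πT).toAlgebra
  let _ : Module (fiberProduct πS πT) M := Module.compHom M (fpToS πS πT)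
  have : IsScalarTower (fiberProduct πS πT) S M := ⟨fun r s m ↦ mul_smul (fpToS πS πT r) s m⟩
  have : Module.Finite (fiberProduct πS πT) S :=
    Module.Finite.of_surjective (Algebra.linearMap _ S) hfS
  have hfin : Module.Finite (fiberProduct πS πT) M := Module.Finite.trans S M
  have hdepth : moduleDepth (fiberProduct πS πT) M = moduleDepth S M :=
    moduleDepth_eq_of_surjective_algebraMap hfS M
  change (_ ∧ _) ↔ (_ ∧ _) ∧ _
  simp only [hfin, hM, true_and]
  rw [hdepth, ringKrullDim_eq_max_of_surjective hfS hfT ker_fpToS_inf_ker_fpToT]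
  cases subsingleton_or_nontrivial M
  · have hS : ringKrullDim S < ⊤ := ringKrullDim_lt_top
    have hT : ringKrullDim T < ⊤ := ringKrullDim_lt_top
    rw [moduleDepth_eq_top_of_subsingleton]
    exact iff_of_false (max_lt hS hT).ne' fun h ↦ hS.ne' h.1
  · have hle := moduleDepth_le_ringKrullDim S M
    constructor
    · intro h
      have hmax := max_le_iff.mp (h ▸ hle)
      exact ⟨le_antisymm hle (h ▸ le_max_left _ _), hmax.2⟩
    · rintro ⟨h, hTS⟩
      rw [h, max_eq_left hTS]
end
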